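/- arXiv:1608.02709 — 2 statements merged into one kernel-verified Lean document; each statement's English description precedes it below -/
import Mathlib

section
/- Let (F_1,…,F_m;k) be an instance of the hMaf problem satisfying the label-set isomorphism property, with {a,b} a minimum maximal sibling-set lying in F_1, such that |E_{F_i}(a,b)| ≤ 1 for all 2 ≤ i ≤ m. Let 𝒞 be the nonempty collection of X-forests F in the instance with |E_F(a,b)| = 1, and suppose L(lca_F(a,b)) = L(lca_{F'}(a,b)) for all F, F' ∈ 𝒞 (Case 2.2.1). Then there exists a hard maximum agreement forest for the X-forests in (F_1,…,F_m;k) in which a and b are a sibling-pair. -/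
/-!
A formalization framework for the Maximum Agreement Forest problem on multiple
rooted multifurcating phylogenetic trees.

An `X`-forest is modeled (up to forced contraction and label-preserving
isomorphism) by the laminar family of the label-sets `L(v)` of its vertices:
every vertex `v` is identified with the set `L(v)` of labels at its leaf
descendants, components correspond to the maximal clusters, leaves to the
singleton clusters, and the edge between a non-root vertex `v` and its parent
is identified with the cluster `L(v)`.
-/

open Finset

noncomputable section
open scoped Classical

/-- A rooted multifurcating phylogenetic `X`-forest, described by the laminar
family of the label sets of its vertices. -/
structure XForest (X : Type*) where
  clusters : Finset (Finset X)
  nonempty_of_mem : ∀ s ∈ clusters, s.Nonempty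
  laminar : ∀ s ∈ clusters, ∀ t ∈ clusters, ¬Disjoint s t → s ⊆ t ∨ t ⊆ s
  singleton_mem : ∀ x : X, {x} ∈ clusters

namespace XForest

variable {X : Type*} [DecidableEq X] [Fintype X]

/-- The connected components of an `X`-forest: the maximal clusters.  The
component `C` is identified with its label set `L(C)`. -/
def components (F : XForest X) : Finset (Finset X) :=
  F.clusters.filter fun s => ∀ t ∈ F.clusters, ¬s ⊂ t

/-- The order of an `X`-forest: its number of connected components. -/
def ord (F : XForest X) : ℕ := F.components.card

/-- `c` is (the cluster of) a child of (the vertex with cluster) `p`. -/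
def IsChild (F : XForest X) (c p : Finset X) : Prop :=
  c ∈ F.clusters ∧ p ∈ F.clusters ∧ c ⊂ p ∧ ∀ t ∈ F.clusters, c ⊂ t → ¬t ⊂ p

/-- The family obtained from the laminar family `A` by removing, for every
`d ∈ D`, the edge between the vertex with cluster `d` and its parent. -/
def cutFam (A D : Finset (Finset X)) : Finset (Finset X) :=
  (A.image fun s => s \ (D.filter fun d => d ⊂ s).biUnion id).filter fun s => s.Nonempty

/-- The `X`-forest obtained from `F` by removing the edges above the clusters
in `D` (followed by forced contraction). -/
def cut (F : XForest X) (D : Finset (Finset X)) : XForest X where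
  clusters := cutFam F.clusters (D.filter fun d => d ∈ F.clusters)
  nonempty_of_mem := fun s hs => (Finset.mem_filter.mp hs).2
  laminar := by
    intro s' hs' t' ht' hnd
    set D' : Finset (Finset X) := D.filter fun d => d ∈ F.clusters with hD'def
    have hD'sub : ∀ d ∈ D', d ∈ F.clusters := fun d hd => (Finset.mem_filter.mp hd).2
    obtain ⟨hs'm, -⟩ := Finset.mem_filter.mp hs'
    obtain ⟨s, hs, rfl⟩ := Finset.mem_image.mp hs'm
    obtain ⟨ht'm, -⟩ := Finset.mem_filter.mp ht'
    obtain ⟨t, ht, rfl⟩ := Finset.mem_image.mp ht'm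
    obtain ⟨x, hxs, hxt⟩ := Finset.not_disjoint_iff.mp hnd
    have key : ∀ u ∈ F.clusters, ∀ w ∈ F.clusters, u ⊆ w →
        ∀ z, z ∈ u \ (D'.filter fun d => d ⊂ u).biUnion id →
          z ∈ w \ (D'.filter fun d => d ⊂ w).biUnion id →
          u \ (D'.filter fun d => d ⊂ u).biUnion id ⊆
            w \ (D'.filter fun d => d ⊂ w).biUnion id := by
      intro u hu w hw huw z hzu hzw y hy
      rw [Finset.mem_sdiff] at hy hzu hzw ⊢
      refine ⟨huw hy.1, ?_⟩
      intro hyU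
      rw [Finset.mem_biUnion] at hyU
      obtain ⟨d, hd, hyd⟩ := hyU
      rw [Finset.mem_filter] at hd
      have hdF : d ∈ F.clusters := hD'sub d hd.1
      have hdw : d ⊂ w := hd.2
      have hlam := F.laminar d hdF u hu (Finset.not_disjoint_iff.mpr ⟨y, hyd, hy.1⟩)
      rcases hlam with hdu | hud
      · by_cases hde : d = u
        · exact hzw.2 (Finset.mem_biUnion.mpr
            ⟨d, Finset.mem_filter.mpr ⟨hd.1, hdw⟩, hde ▸ hzu.1⟩)
        · have hss : d ⊂ u := Finset.ssubset_iff_subset_ne.mpr ⟨hdu, hde⟩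
          exact hy.2 (Finset.mem_biUnion.mpr
            ⟨d, Finset.mem_filter.mpr ⟨hd.1, hss⟩, hyd⟩)
      · exact hzw.2 (Finset.mem_biUnion.mpr
          ⟨d, Finset.mem_filter.mpr ⟨hd.1, hdw⟩, hud hzu.1⟩)
    have hxs' : x ∈ s ∧ x ∈ t := by
      constructor
      · exact (Finset.mem_sdiff.mp hxs).1
      · exact (Finset.mem_sdiff.mp hxt).1
    rcases F.laminar s hs t ht (Finset.not_disjoint_iff.mpr ⟨x, hxs'.1, hxs'.2⟩) with hst | hts
    · exact Or.inl (key s hs t ht hst x hxs hxt)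
    · exact Or.inr (key t ht s hs hts x hxt hxs)
  singleton_mem := by
    intro x
    have hU : ((D.filter fun d => d ∈ F.clusters).filter fun d => d ⊂ ({x} : Finset X)) = ∅ := by
      rw [Finset.filter_eq_empty_iff]
      intro d hd hss
      have hne := F.nonempty_of_mem d (Finset.mem_filter.mp hd).2
      rw [Finset.ssubset_singleton_iff.mp hss] at hne
      exact Finset.not_nonempty_empty hne
    refine Finset.mem_filter.mpr ⟨?_, Finset.singleton_nonempty x⟩
    refine Finset.mem_image.mpr ⟨{x}, F.singleton_mem x, ?_⟩
    rw [hU]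
    simp

/-- `G` is a subforest of `F` (up to forced contraction and label-preserving
isomorphism): `G` is obtained from `F` by removing a set of edges. -/
def IsSubforest (G F : XForest X) : Prop :=
  ∃ D ⊆ F.clusters, G.clusters = (F.cut D).clusters

/-- The edge of `F` between the vertex with cluster `c` and its parent is *in*
the forest `G` (i.e. it lies on a path of `F` connecting two labels that belong
to a common connected component of `G`). -/
def EdgeUsed (F : XForest X) (c : Finset X) (G : XForest X) : Prop :=
  ∃ x ∈ c, ∃ y, y ∉ c ∧ (∃ C ∈ F.components, x ∈ C ∧ y ∈ C) ∧
    ∃ D ∈ G.components, x ∈ D ∧ y ∈ D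

/-- The least common ancestor of the two labels `a` and `b` in `F` (given as
its cluster, i.e. as the label set `L(lca_F(a,b))`). -/
def lca2 (F : XForest X) (a b : X) : Finset X :=
  (F.clusters.filter fun s => a ∈ s ∧ b ∈ s).inf id

/-- The least common ancestor of the labels of `S` in `F` (given as its
cluster). -/
def lcaS (F : XForest X) (S : Finset X) : Finset X :=
  (F.clusters.filter fun s => S ⊆ s).inf id

/-- `E^1_F(a,b)`: the edges of `F` that are not on the path `P` connecting the
labels `a` and `b` but are incident to internal vertices of this path other
than `lca_F(a,b)` (each edge is identified with the cluster of its lower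
endpoint). -/
def E1 (F : XForest X) (a b : X) : Finset (Finset X) :=
  F.clusters.filter fun d => ∃ c ∈ F.clusters, F.IsChild d c ∧ c ⊂ F.lca2 a b ∧
    ((a ∈ c ∧ c ≠ {a} ∧ a ∉ d) ∨ (b ∈ c ∧ c ≠ {b} ∧ b ∉ d))

/-- `E^2_F(a,b)`: the edges incident to `lca_F(a,b)` other than the two edges
on the path connecting `a` and `b` and the edge to the parent of the lca. -/
def E2 (F : XForest X) (a b : X) : Finset (Finset X) :=
  F.clusters.filter fun d => F.IsChild d (F.lca2 a b) ∧ a ∉ d ∧ b ∉ d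

/-- `E_F(a,b) = E^1_F(a,b) ∪ E^2_F(a,b)`. -/
def Eset (F : XForest X) (a b : X) : Finset (Finset X) := F.E1 a b ∪ F.E2 a b

/-- `E^O_F(S)`: the edges between `lca_F(S)` and its children that are not
labels in `S`. -/
def EO (F : XForest X) (S : Finset X) : Finset (Finset X) :=
  F.clusters.filter fun d => F.IsChild d (F.lcaS S) ∧ ∀ x ∈ S, d ≠ {x}

/-- `S` is a maximal sibling set (MSS) of `F`: the leaves with labels in `S`
have a common parent `p` whose children are exactly the labels in `S`
(equivalently, `S` itself is a cluster all of whose proper subclusters are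
singletons). -/
def IsMSS (F : XForest X) (S : Finset X) : Prop :=
  S ∈ F.clusters ∧ 2 ≤ S.card ∧ ∀ c ∈ F.clusters, c ⊂ S → c.card = 1

/-- the labels in `S` are (pairwise) siblings in `F`, i.e., they have a common
parent. -/
def Siblings (F : XForest X) (S : Finset X) : Prop :=
  ∃ p ∈ F.clusters, ∀ x ∈ S, F.IsChild {x} p

/-- An `X`-forest is binary if each of its non-leaf vertices has exactly two
children. -/
def IsBinary (F : XForest X) : Prop :=
  ∀ s ∈ F.clusters, 2 ≤ s.card → ∃ c₁ c₂ : Finset X, c₁ ≠ c₂ ∧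
    F.IsChild c₁ s ∧ F.IsChild c₂ s ∧ ∀ c, F.IsChild c s → c = c₁ ∨ c = c₂

/-- `B` is a resolution of `F`: `F` can be obtained from `B` by contracting
internal edges. -/
def IsResolution (B F : XForest X) : Prop :=
  F.clusters ⊆ B.clusters ∧ B.components = F.components

/-- `G` is a binary subforest of `F`: `G` is binary and is a subforest of some
binary resolution of `F`. -/
def IsBinarySubforest (G F : XForest X) : Prop :=
  G.IsBinary ∧ ∃ B : XForest X, B.IsBinary ∧ IsResolution B F ∧ IsSubforest G B

end XForest

variable {X : Type*} [DecidableEq X] [Fintype X] {m : ℕ}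

/-- A hard agreement forest for the `X`-forests `Fs`. -/
def IsHAF (Fs : Fin m → XForest X) (G : XForest X) : Prop :=
  ∀ i, XForest.IsSubforest G (Fs i)

/-- A hard maximum agreement forest (hMAF) for the `X`-forests `Fs`. -/
def IsHMAF (Fs : Fin m → XForest X) (G : XForest X) : Prop :=
  IsHAF Fs G ∧ ∀ G', IsHAF Fs G' → G.ord ≤ G'.ord

/-- A soft agreement forest for the `X`-forests `Fs`. -/
def IsSAF (Fs : Fin m → XForest X) (G : XForest X) : Prop :=
  ∀ i, XForest.IsBinarySubforest G (Fs i)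

/-- A soft maximum agreement forest (sMAF) for the `X`-forests `Fs`. -/
def IsSMAF (Fs : Fin m → XForest X) (G : XForest X) : Prop :=
  IsSAF Fs G ∧ ∀ G', IsSAF Fs G' → G.ord ≤ G'.ord

/-- An instance `(F_1, …, F_m; k)` of the (hard or soft) Maf problem. -/
structure Inst (X : Type*) (m : ℕ) where
  F : Fin m → XForest X
  k : ℤ

namespace Inst

/-- the largest order of an `X`-forest in the instance. -/
def ordMax (I : Inst X m) : ℕ := Finset.univ.sup fun i => (I.F i).ord

/-- a solution of an instance of the hMaf problem: a hard agreement forest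
whose order is at most `ordMax + k`. -/
def IsSolution (I : Inst X m) (G : XForest X) : Prop :=
  IsHAF I.F G ∧ (G.ord : ℤ) ≤ (I.ordMax : ℤ) + I.k

/-- a yes-instance of the hMaf problem. -/
def IsYes (I : Inst X m) : Prop := ∃ G, I.IsSolution G

/-- a solution of an instance of the sMaf problem. -/
def IsSSolution (I : Inst X m) (G : XForest X) : Prop :=
  IsSAF I.F G ∧ (G.ord : ℤ) ≤ (I.ordMax : ℤ) + I.k

/-- a yes-instance of the sMaf problem. -/
def IsSYes (I : Inst X m) : Prop := ∃ G, I.IsSSolution G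

/-- `S` is a minimum maximal sibling set of the instance `I`, lying in the
`i`-th forest. -/
def MinMSS (I : Inst X m) (i : Fin m) (S : Finset X) : Prop :=
  (I.F i).IsMSS S ∧ ∀ j : Fin m, ∀ S' : Finset X, (I.F j).IsMSS S' → S.card ≤ S'.card

end Inst

/-- the new value of the parameter after removing one edge from the `j`-th
forest (the maximum order `ordMax + k` stays invariant). -/
def cutk (I : Inst X m) (j : Fin m) : ℤ :=
  if (I.F j).ord = I.ordMax then I.k - 1 else I.k

/-- Reduction Rule 1 is applicable on `Fj` relative to `Fi`, at the vertex `v`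
of `Fj` (whose parent edge is to be removed): there is a subset
`{C_1, …, C_t}` (`t ≥ 1`) of the components of `Fi` and a component `C` of
`Fj` containing a non-root vertex `v` with
`L(v) = L(C) ∩ (L(C_1) ∪ … ∪ L(C_t))`. -/
def RR1App (Fi Fj : XForest X) (v : Finset X) : Prop :=
  ∃ 𝒞 ⊆ Fi.components, 𝒞.Nonempty ∧
    ∃ C ∈ Fj.components, v ∈ Fj.clusters ∧ v ⊆ C ∧ (∃ t ∈ Fj.clusters, v ⊂ t) ∧
      v = C ∩ 𝒞.biUnion id

/-- One application of Reduction Rule 1 to the instance `I`, producing `I'`. -/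
def RR1Step (I I' : Inst X m) : Prop :=
  ∃ i j, i ≠ j ∧ ∃ v, RR1App (I.F i) (I.F j) v ∧
    I' = ⟨Function.update I.F j ((I.F j).cut {v}), cutk I j⟩

/-- Reduction Rule 1 is applicable somewhere on the instance `I`. -/
def RR1Applicable (I : Inst X m) : Prop :=
  ∃ i j, i ≠ j ∧ ∃ v, RR1App (I.F i) (I.F j) v

/-- `I'` is obtained from `I` by applying Reduction Rule 1 repeatedly until it
is no longer applicable. -/
def RR1Exhaust (I I' : Inst X m) : Prop :=
  Relation.ReflTransGen RR1Step I I' ∧ ¬RR1Applicable I'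

/-- The situation of Case 1 (Branching Rule 1) for `Fj` relative to `Fi`:
there is a component `C` of `Fi` and a vertex `v` of `Fj` with two children
`c₁, c₂` such that `L(c₁) ⊆ L(C)` and `L(c₂) ∩ L(C) = ∅`. -/
def BR1AppCore (Fi Fj : XForest X) (v c₁ c₂ : Finset X) : Prop :=
  ∃ C ∈ Fi.components, Fj.IsChild c₁ v ∧ Fj.IsChild c₂ v ∧ c₁ ≠ c₂ ∧
    c₁ ⊆ C ∧ c₂ ∩ C = ∅

/-- An application of Branching Rule 1 to the instance `I` (on the forest with
index `j`, relative to the forest with index `i`), branching into the two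
instances `I₁` (removing `[v,c₁]`) and `I₂` (removing `[v,c₂]`). -/
def BR1Branch (I : Inst X m) (i j : Fin m) (v c₁ c₂ : Finset X)
    (I₁ I₂ : Inst X m) : Prop :=
  i ≠ j ∧ BR1AppCore (I.F i) (I.F j) v c₁ c₂ ∧
    I₁ = ⟨Function.update I.F j ((I.F j).cut {c₁}), cutk I j⟩ ∧
    I₂ = ⟨Function.update I.F j ((I.F j).cut {c₂}), cutk I j⟩

/-- two `X`-forests satisfy the label-set isomorphism property. -/
def LabelIso (F F' : XForest X) : Prop := F.components = F'.components

/-- an instance satisfies the label-set isomorphism property. -/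
def InstLabelIso (I : Inst X m) : Prop := ∀ i j, LabelIso (I.F i) (I.F j)

/-- One computation path of the 2-BR-process on the forests with indices `p`
and `q`: repeatedly apply Branching Rule 1 between these two forests (choosing
one of the two branches) followed by an exhaustive application of Reduction
Rule 1, until the two forests satisfy the label-set isomorphism property.  The
natural number records the number of edges removed by Branching Rule 1 along
the path. -/
inductive TwoBRPath {X : Type*} [DecidableEq X] [Fintype X] {m : ℕ} (p q : Fin m) :
    Inst X m → Inst X m → ℕ → Prop
  | done (I : Inst X m) (h : LabelIso (I.F p) (I.F q)) : TwoBRPath p q I I 0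
  | step {I I₁ I₂ J K I' : Inst X m} {n : ℕ} {i j : Fin m} {v c₁ c₂ : Finset X}
      (hij : (i = p ∧ j = q) ∨ (i = q ∧ j = p))
      (hbr : BR1Branch I i j v c₁ c₂ I₁ I₂)
      (hpick : J = I₁ ∨ J = I₂)
      (hex : RR1Exhaust J K)
      (hrest : TwoBRPath p q K I' n) : TwoBRPath p q I I' (n + 1)

/-- `s` and `t` are the indices of two forests with the first and the second
largest orders in `I`. -/
def FirstSecond (I : Inst X m) (s t : Fin m) : Prop :=
  s ≠ t ∧ (∀ i, (I.F i).ord ≤ (I.F s).ord) ∧ ∀ i, i ≠ s → (I.F i).ord ≤ (I.F t).ord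

/-- One computation path of Stage 2 of the m-BR-process: repeatedly apply the
2-BR-process to two forests with first and second largest orders not
satisfying the label-set isomorphism property, until the whole instance
satisfies the label-set isomorphism property. -/
inductive MBRAux {X : Type*} [DecidableEq X] [Fintype X] {m : ℕ} :
    Inst X m → Inst X m → ℕ → Prop
  | done (I : Inst X m) (h : InstLabelIso I) : MBRAux I I 0
  | step {I J I' : Inst X m} {a b : ℕ} {s t : Fin m}
      (hst : FirstSecond I s t) (hni : ¬LabelIso (I.F s) (I.F t))
      (h2 : TwoBRPath s t I J a) (hrest : MBRAux J I' b) : MBRAux I I' (a + b)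

/-- One computation path of the m-BR-process on the instance `I`, ending at
the instance `I'`, along which `n` edges are removed by Branching Rule 1. -/
def MBRPath (I I' : Inst X m) (n : ℕ) : Prop :=
  ∃ J, RR1Exhaust I J ∧ MBRAux J I' n

/-- The full branching tree of the 2-BR-process on the forests with indices
`p` and `q`, producing the collection (list) of resulting instances, each
together with the number of edges removed by Branching Rule 1 on its
computation path. -/
inductive TwoBRTree {X : Type*} [DecidableEq X] [Fintype X] {m : ℕ} (p q : Fin m) :
    Inst X m → List (Inst X m × ℕ) → Prop
  | done (I : Inst X m) (h : LabelIso (I.F p) (I.F q)) : TwoBRTree p q I [(I, 0)]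
  | step {I I₁ I₂ K₁ K₂ : Inst X m} {L₁ L₂ : List (Inst X m × ℕ)}
      {i j : Fin m} {v c₁ c₂ : Finset X}
      (hij : (i = p ∧ j = q) ∨ (i = q ∧ j = p))
      (hbr : BR1Branch I i j v c₁ c₂ I₁ I₂)
      (he₁ : RR1Exhaust I₁ K₁) (he₂ : RR1Exhaust I₂ K₂)
      (h₁ : TwoBRTree p q K₁ L₁) (h₂ : TwoBRTree p q K₂ L₂) :
      TwoBRTree p q I ((L₁ ++ L₂).map fun x => (x.1, x.2 + 1))

/-- One step of Stage 2 of the m-BR-process on a collection of instances: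
replace an instance, in which two forests of first and second largest orders
do not satisfy the label-set isomorphism property, by the collection produced
by the 2-BR-process on those two forests. -/
inductive CollStep {X : Type*} [DecidableEq X] [Fintype X] {m : ℕ} :
    List (Inst X m × ℕ) → List (Inst X m × ℕ) → Prop
  | step {I : Inst X m} {n : ℕ} {A B L : List (Inst X m × ℕ)} {s t : Fin m}
      (hst : FirstSecond I s t) (hni : ¬LabelIso (I.F s) (I.F t))
      (h : TwoBRTree s t I L) :
      CollStep (A ++ (I, n) :: B) (A ++ L.map (fun y => (y.1, y.2 + n)) ++ B)

/-- The m-BR-process on the instance `I` produces the collection `L` of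
instances (each recorded with the number of edges removed by Branching Rule 1
on the path leading to it): Stage 1 applies Reduction Rule 1 exhaustively, and
Stage 2 repeatedly applies the 2-BR-process until every instance of the
collection satisfies the label-set isomorphism property. -/
def MBRTree (I : Inst X m) (L : List (Inst X m × ℕ)) : Prop :=
  ∃ J, RR1Exhaust I J ∧ Relation.ReflTransGen CollStep [(J, 0)] L ∧
    ∀ x ∈ L, InstLabelIso x.1

/-- The 2-edge distance property of an instance. -/
def TwoEdgeDist (I : Inst X m) : Prop :=
  ∃ (G : Inst X m) (E : Fin m → Finset (Finset X)),
    InstLabelIso G ∧ G.k = I.k + 1 ∧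
    (∀ i, E i ⊆ (G.F i).clusters) ∧ (∀ i, (E i).card ≤ 1) ∧
    (∀ i, ∀ v ∈ E i, ∃ t ∈ (G.F i).clusters, v ⊂ t) ∧
    (∀ i, (I.F i).clusters = ((G.F i).cut (E i)).clusters) ∧
    ∃ i j : Fin m, i < j ∧ ∃ vi ∈ E i, ∃ vj ∈ E j, vi ≠ vj

/-- A branching step producing instances with parameters `ks` from an instance
with parameter `k` satisfies the recurrence relation
`T(k) ≤ c₁·T(k-1) + c₂·T(k-2)`:  for every nonnegative monotone `T` satisfying
the recurrence, the sum of the `T`-values of the produced parameters is at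
most `T k`. -/
def RecBound (k : ℤ) (ks : List ℤ) (c₁ c₂ : ℕ) : Prop :=
  ∀ T : ℤ → ℝ, (∀ x, 0 ≤ T x) → Monotone T →
    (∀ x : ℤ, (c₁ : ℝ) * T (x - 1) + (c₂ : ℝ) * T (x - 2) ≤ T x) →
    (ks.map T).sum ≤ T k

end

set_option linter.unusedSectionVars false

namespace HMafAux

variable {X : Type*} [DecidableEq X] [Fintype X]

open XForest

theorem comp_mem {F : XForest X} {C : Finset X} (h : C ∈ F.components) : C ∈ F.clusters :=
  (Finset.mem_filter.mp h).1

theorem comp_max {F : XForest X} {C t : Finset X} (h : C ∈ F.components)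
    (ht : t ∈ F.clusters) (hs : C ⊆ t) : C = t := by
  by_contra hne
  exact (Finset.mem_filter.mp h).2 t ht (Finset.ssubset_iff_subset_ne.mpr ⟨hs, hne⟩)

theorem mem_comp {F : XForest X} {C : Finset X} (h : C ∈ F.clusters)
    (hm : ∀ t ∈ F.clusters, C ⊆ t → t ⊆ C) : C ∈ F.components := by
  refine Finset.mem_filter.mpr ⟨h, fun t ht hs => hs.2 (hm t ht hs.1)⟩

theorem exists_comp {F : XForest X} {s : Finset X} (h : s ∈ F.clusters) :
    ∃ C ∈ F.components, s ⊆ C := by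
  obtain ⟨C, hC, hmax⟩ := (F.clusters.filter fun t => s ⊆ t).exists_max_image
    Finset.card ⟨s, Finset.mem_filter.mpr ⟨h, subset_rfl⟩⟩
  rw [Finset.mem_filter] at hC
  refine ⟨C, mem_comp hC.1 ?_, hC.2⟩
  intro t ht hCt
  have := hmax t (Finset.mem_filter.mpr ⟨ht, hC.2.trans hCt⟩)
  exact (Finset.eq_of_subset_of_card_le hCt this).symm.subset

theorem exists_comp' (F : XForest X) (x : X) : ∃ C ∈ F.components, x ∈ C := by
  obtain ⟨C, hC, h⟩ := exists_comp (F.singleton_mem x)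
  exact ⟨C, hC, by simpa using h⟩

theorem sub_comp {F : XForest X} {C s : Finset X} {x : X} (hC : C ∈ F.components)
    (hs : s ∈ F.clusters) (h1 : x ∈ C) (h2 : x ∈ s) : s ⊆ C := by
  rcases F.laminar C (comp_mem hC) s hs (Finset.not_disjoint_iff.mpr ⟨x, h1, h2⟩) with h | h
  · exact (comp_max hC hs h).symm.subset
  · exact h

theorem comp_eq {F : XForest X} {C D : Finset X} {x : X} (hC : C ∈ F.components)
    (hD : D ∈ F.components) (h1 : x ∈ C) (h2 : x ∈ D) : C = D :=
  Finset.Subset.antisymm (sub_comp hD (comp_mem hC) h2 h1) (sub_comp hC (comp_mem hD) h1 h2)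

theorem lam {F : XForest X} {s t : Finset X} {x : X} (hs : s ∈ F.clusters)
    (ht : t ∈ F.clusters) (h1 : x ∈ s) (h2 : x ∈ t) : s ⊆ t ∨ t ⊆ s :=
  F.laminar s hs t ht (Finset.not_disjoint_iff.mpr ⟨x, h1, h2⟩)

theorem lam' {F : XForest X} {s t : Finset X} {x : X} (hs : s ∈ F.clusters)
    (ht : t ∈ F.clusters) (h1 : x ∈ s) (h2 : x ∈ t) : s ⊂ t ∨ t ⊆ s := by
  rcases lam hs ht h1 h2 with h | h
  · by_cases h' : t ⊆ s
    · exact Or.inr h'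
    · exact Or.inl ⟨h, h'⟩
  · exact Or.inr h

/-- Combinatorial characterization of subforests. -/
structure Sub (G F : XForest X) : Prop where
  disj : ∀ C ∈ G.components, ∀ D ∈ G.components, C ≠ D → ∀ s ∈ F.clusters,
    (C ∩ s).Nonempty → (D ∩ s).Nonempty → ∃ t ∈ F.clusters, t ⊂ s ∧ (C ⊆ t ∨ D ⊆ t)
  down : ∀ t ∈ G.clusters, ∃ C ∈ G.components, ∃ s ∈ F.clusters, t = C ∩ s
  up : ∀ C ∈ G.components, ∀ s ∈ F.clusters, (C ∩ s).Nonempty → C ∩ s ∈ G.clusters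

theorem mem_cut {F : XForest X} {D : Finset (Finset X)} (hD : D ⊆ F.clusters) {t : Finset X} :
    t ∈ (F.cut D).clusters ↔ t.Nonempty ∧ ∃ s ∈ F.clusters,
      ∀ x, x ∈ t ↔ x ∈ s ∧ ∀ d ∈ D, d ⊂ s → x ∉ d := by
  have key : ∀ s : Finset X, ∀ x, x ∈ s \ ((D.filter fun d => d ∈ F.clusters).filter
      fun d => d ⊂ s).biUnion id ↔ x ∈ s ∧ ∀ d ∈ D, d ⊂ s → x ∉ d := by
    intro s x
    simp only [Finset.mem_sdiff, Finset.mem_biUnion, Finset.mem_filter, id]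
    constructor
    · rintro ⟨h1, h2⟩
      exact ⟨h1, fun d hd hds hx => h2 ⟨d, ⟨⟨hd, hD hd⟩, hds⟩, hx⟩⟩
    · rintro ⟨h1, h2⟩
      refine ⟨h1, ?_⟩
      rintro ⟨d, ⟨⟨hd, -⟩, hds⟩, hx⟩
      exact h2 d hd hds hx
  constructor
  · intro h
    obtain ⟨h1, h2⟩ := Finset.mem_filter.mp h
    obtain ⟨s, hs, rfl⟩ := Finset.mem_image.mp h1
    exact ⟨h2, s, hs, fun x => by rw [← key]⟩
  · rintro ⟨h1, s, hs, h2⟩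
    refine Finset.mem_filter.mpr ⟨Finset.mem_image.mpr ⟨s, hs, ?_⟩, h1⟩
    ext x
    rw [h2, ← key]

theorem exists_lca {F : XForest X} {C : Finset X} (h : ∃ s ∈ F.clusters, C ⊆ s) :
    ∃ l ∈ F.clusters, C ⊆ l ∧ ∀ t ∈ F.clusters, t ⊂ l → ¬ C ⊆ t := by
  obtain ⟨s, hs, hCs⟩ := h
  obtain ⟨l, hl, hmin⟩ := (F.clusters.filter fun t => C ⊆ t).exists_min_image
    Finset.card ⟨s, Finset.mem_filter.mpr ⟨hs, hCs⟩⟩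
  rw [Finset.mem_filter] at hl
  refine ⟨l, hl.1, hl.2, fun t ht htl hCt => ?_⟩
  have := hmin t (Finset.mem_filter.mpr ⟨ht, hCt⟩)
  exact absurd (Finset.card_lt_card htl) (by omega)

theorem sub_of_isSubforest {G F : XForest X} (h : IsSubforest G F) : Sub G F := by
  obtain ⟨D, hD, hG⟩ := h
  have hm : ∀ t, t ∈ G.clusters ↔ t.Nonempty ∧ ∃ s ∈ F.clusters,
      ∀ x, x ∈ t ↔ x ∈ s ∧ ∀ d ∈ D, d ⊂ s → x ∉ d := by
    intro t; rw [hG]; exact mem_cut hD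
  -- residuals
  have res : ∀ s ∈ F.clusters, ∀ x, x ∈ s → (∀ d ∈ D, d ⊂ s → x ∉ d) →
      ∃ t ∈ G.clusters, ∀ x, x ∈ t ↔ x ∈ s ∧ ∀ d ∈ D, d ⊂ s → x ∉ d := by
    classical
    intro s hs x hx hxd
    have hh : ∀ y, y ∈ (s.filter fun x => ∀ d ∈ D, d ⊂ s → x ∉ d) ↔
      y ∈ s ∧ ∀ d ∈ D, d ⊂ s → y ∉ d := fun y => Finset.mem_filter
    exact ⟨_, (hm _).mpr ⟨⟨x, (hh x).mpr ⟨hx, hxd⟩⟩, s, hs, hh⟩, hh⟩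
  refine ⟨?_, ?_, ?_⟩
  · intro C hC C' hC' hne s hs ⟨x, hx⟩ ⟨x', hx'⟩
    rw [Finset.mem_inter] at hx hx'
    obtain ⟨-, s0, hs0, h0⟩ := (hm C).mp (comp_mem hC)
    obtain ⟨-, s1, hs1, h1⟩ := (hm C').mp (comp_mem hC')
    rcases lam' hs0 hs ((h0 x).mp hx.1).1 hx.2 with h | h
    · exact ⟨s0, hs0, h, Or.inl fun y hy => ((h0 y).mp hy).1⟩
    rcases lam' hs1 hs ((h1 x').mp hx'.1).1 hx'.2 with h' | h'
    · exact ⟨s1, hs1, h', Or.inr fun y hy => ((h1 y).mp hy).1⟩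
    exfalso
    obtain ⟨t, ht, htm⟩ := res s hs x hx.2
      (fun d hd hds => ((h0 x).mp hx.1).2 d hd (hds.trans_subset h))
    have e1 : t ⊆ C := sub_comp hC ht hx.1 ((htm x).mpr
      ⟨hx.2, fun d hd hds => ((h0 x).mp hx.1).2 d hd (hds.trans_subset h)⟩)
    have hx't : x' ∈ t := (htm x').mpr
      ⟨hx'.2, fun d hd hds => ((h1 x').mp hx'.1).2 d hd (hds.trans_subset h')⟩
    exact hne (comp_eq hC hC' (e1 hx't) hx'.1)
  · intro t ht
    obtain ⟨C, hC, htC⟩ := exists_comp ht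
    obtain ⟨⟨x, hx⟩, s, hs, h⟩ := (hm t).mp ht
    obtain ⟨-, s0, hs0, h0⟩ := (hm C).mp (comp_mem hC)
    refine ⟨C, hC, s, hs, ?_⟩
    ext y
    rw [Finset.mem_inter]
    constructor
    · intro hy
      exact ⟨htC hy, ((h y).mp hy).1⟩
    · rintro ⟨hyC, hys⟩
      refine (h y).mpr ⟨hys, fun d hd hds hyd => ?_⟩
      have hy0 := (h0 y).mp hyC
      have hx0 := (h0 x).mp (htC hx)
      rcases lam' hs0 hs hx0.1 ((h x).mp hx).1 with h' | h'
      · rcases lam' (hD hd) hs0 hyd hy0.1 with h'' | h''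
        · exact hy0.2 d hd h'' hyd
        · exact ((h x).mp hx).2 d hd hds (h'' hx0.1)
      · exact hy0.2 d hd (hds.trans_subset h') hyd
  · intro C hC s hs ⟨x, hx⟩
    rw [Finset.mem_inter] at hx
    obtain ⟨-, s0, hs0, h0⟩ := (hm C).mp (comp_mem hC)
    have hx0 := (h0 x).mp hx.1
    rcases lam hs0 hs hx0.1 hx.2 with h | h
    · have : C ∩ s = C := Finset.inter_eq_left.mpr fun y hy => h ((h0 y).mp hy).1
      rw [this]; exact comp_mem hC
    · obtain ⟨t, ht, htm⟩ := res s hs x hx.2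
        (fun d hd hds => hx0.2 d hd (hds.trans_subset h))
      have hxt : x ∈ t := (htm x).mpr ⟨hx.2, fun d hd hds => hx0.2 d hd (hds.trans_subset h)⟩
      have htC := sub_comp hC ht hx.1 hxt
      have : C ∩ s = t := by
        ext y
        rw [Finset.mem_inter]
        constructor
        · rintro ⟨hy, hys⟩
          exact (htm y).mpr ⟨hys, fun d hd hds => ((h0 y).mp hy).2 d hd (hds.trans_subset h)⟩
        · intro hy
          exact ⟨htC hy, ((htm y).mp hy).1⟩
      rw [this]; exact ht

theorem isSubforest_of_sub {G F : XForest X} (h : Sub G F) : IsSubforest G F := by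
  classical
  let D : Finset (Finset X) := F.clusters.filter fun d => ∃ C ∈ G.components, C ⊆ d ∧
    ∀ t ∈ F.clusters, t ⊂ d → ¬ C ⊆ t
  have hD : D ⊆ F.clusters := Finset.filter_subset _ _
  have hDm : ∀ d, d ∈ D ↔ d ∈ F.clusters ∧ ∃ C ∈ G.components, C ⊆ d ∧
    ∀ t ∈ F.clusters, t ⊂ d → ¬ C ⊆ t := fun d => Finset.mem_filter
  have hlc : ∀ C ∈ G.components, ∀ t ∈ F.clusters, C ⊆ t →
      ∃ d ∈ D, C ⊆ d ∧ d ⊆ t := by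
    intro C hC t ht hCt
    obtain ⟨l, hl, h1, h2⟩ := exists_lca ⟨t, ht, hCt⟩
    refine ⟨l, (hDm l).mpr ⟨hl, C, hC, h1, h2⟩, h1, ?_⟩
    obtain ⟨x, hx⟩ := G.nonempty_of_mem C (comp_mem hC)
    rcases lam' ht hl (hCt hx) (h1 hx) with h' | h'
    · exact absurd hCt (h2 t ht h')
    · exact h'
  -- the residual of `s` containing `x` is `C ∩ s`
  have key : ∀ s ∈ F.clusters, ∀ C ∈ G.components, ∀ x ∈ C, x ∈ s →
      (∀ d ∈ D, d ⊂ s → x ∉ d) → ∀ y, y ∈ C ∩ s ↔ y ∈ s ∧ ∀ d ∈ D, d ⊂ s → y ∉ d := by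
    intro s hs C hC x hxC hxs hxd y
    rw [Finset.mem_inter]
    constructor
    · rintro ⟨hyC, hys⟩
      refine ⟨hys, fun d hd hds hyd => ?_⟩
      obtain ⟨hdF, C', hC', hC'd, hmin⟩ := (hDm d).mp hd
      by_cases hCC : C' = C
      · subst hCC; exact hxd d hd hds (hC'd hxC)
      · obtain ⟨z, hz⟩ := G.nonempty_of_mem C' (comp_mem hC')
        obtain ⟨t, ht, htd, h1 | h1⟩ := h.disj C' hC' C hC hCC d hdF
          ⟨z, Finset.mem_inter.mpr ⟨hz, hC'd hz⟩⟩ ⟨y, Finset.mem_inter.mpr ⟨hyC, hyd⟩⟩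
        · exact hmin t ht htd h1
        · exact hxd d hd hds (htd.1 (h1 hxC))
    · rintro ⟨hys, hyd⟩
      refine ⟨?_, hys⟩
      obtain ⟨C', hC', hyC'⟩ := exists_comp' G y
      by_cases hCC : C' = C
      · exact hCC ▸ hyC'
      · exfalso
        obtain ⟨t, ht, hts, h1 | h1⟩ := h.disj C' hC' C hC hCC s hs
          ⟨y, Finset.mem_inter.mpr ⟨hyC', hys⟩⟩ ⟨x, Finset.mem_inter.mpr ⟨hxC, hxs⟩⟩
        · obtain ⟨d, hd, h2, h3⟩ := hlc C' hC' t ht h1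
          exact hyd d hd (lt_of_le_of_lt h3 hts) (h2 hyC')
        · obtain ⟨d, hd, h2, h3⟩ := hlc C hC t ht h1
          exact hxd d hd (lt_of_le_of_lt h3 hts) (h2 hxC)
  refine ⟨D, hD, ?_⟩
  ext t
  rw [mem_cut hD]
  constructor
  · intro ht
    refine ⟨G.nonempty_of_mem t ht, ?_⟩
    obtain ⟨C, hC, s1, hs1, h1⟩ := h.down t ht
    obtain ⟨s, hs, hmin⟩ := (F.clusters.filter fun s => t = C ∩ s).exists_min_image
      Finset.card ⟨s1, Finset.mem_filter.mpr ⟨hs1, h1⟩⟩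
    rw [Finset.mem_filter] at hs
    obtain ⟨hs, hts⟩ := hs
    have hno : ∀ u ∈ F.clusters, u ⊂ s → ¬ C ⊆ u := by
      intro u hu hus hCu
      have e : t = C ∩ u := by
        rw [hts, Finset.inter_eq_left.mpr hCu, Finset.inter_eq_left.mpr (hCu.trans hus.1)]
      have := hmin u (Finset.mem_filter.mpr ⟨hu, e⟩)
      exact absurd (Finset.card_lt_card hus) (by omega)
    obtain ⟨x, hx⟩ := G.nonempty_of_mem t ht
    have hx' := hx
    rw [hts, Finset.mem_inter] at hx'
    refine ⟨s, hs, ?_⟩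
    rw [hts]
    refine key s hs C hC x hx'.1 hx'.2 ?_
    intro d hd hds hxd
    obtain ⟨hdF, C', hC', hC'd, hmin'⟩ := (hDm d).mp hd
    by_cases hCC : C' = C
    · subst hCC; exact hno d hdF hds hC'd
    · obtain ⟨z, hz⟩ := G.nonempty_of_mem C' (comp_mem hC')
      obtain ⟨u, hu, hud, h1 | h1⟩ := h.disj C' hC' C hC hCC d hdF
        ⟨z, Finset.mem_inter.mpr ⟨hz, hC'd hz⟩⟩ ⟨x, Finset.mem_inter.mpr ⟨hx'.1, hxd⟩⟩
      · exact hmin' u hu hud h1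
      · exact hno u hu (hud.trans hds) h1
  · rintro ⟨⟨x, hx⟩, s, hs, htm⟩
    obtain ⟨C, hC, hxC⟩ := exists_comp' G x
    have hx' := (htm x).mp hx
    have hk := key s hs C hC x hxC hx'.1 hx'.2
    have : t = C ∩ s := by
      ext y; rw [htm, hk]
    rw [this]
    exact h.up C hC s hs ⟨x, Finset.mem_inter.mpr ⟨hxC, hx'.1⟩⟩

theorem Sub.trans {G H F : XForest X} (h1 : Sub G H) (h2 : Sub H F) : Sub G F := by
  have hc : ∀ C ∈ G.components, ∃ C' ∈ H.components, C ⊆ C' := by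
    intro C hC
    obtain ⟨_, _, s, hs, e⟩ := h1.down C (comp_mem hC)
    obtain ⟨C', hC', h⟩ := exists_comp hs
    exact ⟨C', hC', fun x hx => h (by rw [e] at hx; exact (Finset.mem_inter.mp hx).2)⟩
  refine ⟨?_, ?_, ?_⟩
  · intro C hC D hD hne s hs hCs hDs
    obtain ⟨C', hC', hCC⟩ := hc C hC
    obtain ⟨D', hD', hDD⟩ := hc D hD
    by_cases he : C' = D'
    · subst he
      obtain ⟨x, hx⟩ := hCs
      obtain ⟨y, hy⟩ := hDs
      rw [Finset.mem_inter] at hx hy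
      have hmem := h2.up C' hC' s hs ⟨x, Finset.mem_inter.mpr ⟨hCC hx.1, hx.2⟩⟩
      obtain ⟨t, ht, hts, hor⟩ := h1.disj C hC D hD hne (C' ∩ s) hmem
        ⟨x, by simp [hx.1, hx.2, hCC hx.1]⟩ ⟨y, by simp [hy.1, hy.2, hDD hy.1]⟩
      obtain ⟨C'', hC'', s', hs', e⟩ := h2.down t ht
      obtain ⟨z, hz⟩ := H.nonempty_of_mem t ht
      have hz1 := hts.1 hz
      have hz2 := hz
      rw [e, Finset.mem_inter] at hz2
      rw [Finset.mem_inter] at hz1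
      have e2 := comp_eq hC'' hC' hz2.1 hz1.1
      subst e2
      rcases lam' hs' hs hz2.2 hz1.2 with h | h
      · have hts' : t ⊆ s' := by rw [e]; exact Finset.inter_subset_right
        exact ⟨s', hs', h, hor.imp (fun q => q.trans hts') (fun q => q.trans hts')⟩
      · exfalso
        apply hts.2
        rw [e]
        exact Finset.inter_subset_inter_left h
    · obtain ⟨t, ht, hts, hor⟩ := h2.disj C' hC' D' hD' he s hs
        (hCs.mono (Finset.inter_subset_inter_right hCC))
        (hDs.mono (Finset.inter_subset_inter_right hDD))
      exact ⟨t, ht, hts, hor.imp (fun q => hCC.trans q) (fun q => hDD.trans q)⟩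
  · intro t ht
    obtain ⟨C, hC, u, hu, e⟩ := h1.down t ht
    obtain ⟨C', hC', s, hs, e'⟩ := h2.down u hu
    refine ⟨C, hC, s, hs, ?_⟩
    obtain ⟨x, hx⟩ := G.nonempty_of_mem t ht
    rw [e, e'] at hx
    simp only [Finset.mem_inter] at hx
    obtain ⟨C'', hC'', hCC⟩ := hc C hC
    have := comp_eq hC' hC'' hx.2.1 (hCC hx.1)
    subst this
    rw [e, e', ← Finset.inter_assoc, Finset.inter_eq_left.mpr hCC]
  · intro C hC s hs ⟨x, hx⟩
    rw [Finset.mem_inter] at hx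
    obtain ⟨C', hC', hCC⟩ := hc C hC
    have e : C ∩ s = C ∩ (C' ∩ s) := by
      rw [← Finset.inter_assoc, Finset.inter_eq_left.mpr hCC]
    rw [e]
    refine h1.up C hC _ (h2.up C' hC' s hs ⟨x, ?_⟩) ⟨x, ?_⟩ <;>
      simp [hx.1, hx.2, hCC hx.1]

/-- The discrete forest. -/
def discrete (X : Type*) [DecidableEq X] [Fintype X] : XForest X where
  clusters := Finset.univ.image fun x : X => ({x} : Finset X)
  nonempty_of_mem := by
    intro s hs
    obtain ⟨x, -, rfl⟩ := Finset.mem_image.mp hs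
    exact Finset.singleton_nonempty x
  laminar := by
    intro s hs t ht h
    obtain ⟨x, -, rfl⟩ := Finset.mem_image.mp hs
    obtain ⟨y, -, rfl⟩ := Finset.mem_image.mp ht
    left
    simpa using h
  singleton_mem := fun x => Finset.mem_image.mpr ⟨x, Finset.mem_univ x, rfl⟩

theorem discrete_sub (F : XForest X) : Sub (discrete X) F := by
  have hm : ∀ C, C ∈ (discrete X).clusters → ∃ x, C = {x} := by
    intro C hC
    obtain ⟨x, -, rfl⟩ := Finset.mem_image.mp hC
    exact ⟨x, rfl⟩
  refine ⟨?_, ?_, ?_⟩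
  · intro C hC D hD hne s hs hCs hDs
    obtain ⟨x, rfl⟩ := hm C (comp_mem hC)
    obtain ⟨y, rfl⟩ := hm D (comp_mem hD)
    obtain ⟨x', hx⟩ := hCs
    obtain ⟨y', hy⟩ := hDs
    simp only [Finset.mem_inter, Finset.mem_singleton] at hx hy
    obtain ⟨rfl, hx⟩ := hx
    obtain ⟨rfl, hy⟩ := hy
    refine ⟨{x'}, F.singleton_mem x', ⟨by simpa using hx, fun h => hne ?_⟩, Or.inl subset_rfl⟩
    have := h hy
    rw [Finset.mem_singleton] at this
    rw [this]
  · intro t ht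
    obtain ⟨x, rfl⟩ := hm t ht
    obtain ⟨C, hC, hx⟩ := exists_comp' (discrete X) x
    refine ⟨C, hC, {x}, F.singleton_mem x, ?_⟩
    ext y; simp only [Finset.mem_singleton, Finset.mem_inter]
    constructor
    · rintro rfl; exact ⟨hx, rfl⟩
    · exact fun h => h.2
  · intro C hC s hs hne
    obtain ⟨x, rfl⟩ := hm C (comp_mem hC)
    obtain ⟨y, hy⟩ := hne
    simp only [Finset.mem_inter, Finset.mem_singleton] at hy
    rw [Finset.inter_eq_left.mpr (by simpa [← hy.1] using hy.2)]
    exact (discrete X).singleton_mem x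

theorem exists_hmaf {m : ℕ} (Fs : Fin m → XForest X) : ∃ G, IsHMAF Fs G := by
  classical
  have hex : ∃ n, ∃ G, IsHAF Fs G ∧ G.ord = n :=
    ⟨_, discrete X, fun i => isSubforest_of_sub (discrete_sub (Fs i)), rfl⟩
  obtain ⟨G, hG, hn⟩ := Nat.find_spec hex
  refine ⟨G, hG, fun G' hG' => ?_⟩
  rw [hn]
  exact Nat.find_min' hex ⟨G', hG', rfl⟩

/-- relabelling used when attaching `a` next to `b`. -/
def phi (a b : X) (s : Finset X) : Finset X := if b ∈ s then insert a s else s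

theorem phi_mem {a b : X} {s : Finset X} (h : b ∈ s) : phi a b s = insert a s := if_pos h
theorem phi_not {a b : X} {s : Finset X} (h : b ∉ s) : phi a b s = s := if_neg h

theorem subset_phi (a b : X) (s : Finset X) : s ⊆ phi a b s := by
  by_cases h : b ∈ s
  · rw [phi_mem h]; exact Finset.subset_insert _ _
  · rw [phi_not h]

theorem phi_mono (a b : X) {s t : Finset X} (h : s ⊆ t) : phi a b s ⊆ phi a b t := by
  by_cases hs : b ∈ s
  · rw [phi_mem hs, phi_mem (h hs)]; exact Finset.insert_subset_insert _ h
  · rw [phi_not hs]; exact h.trans (subset_phi _ _ _)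

/-- Attach the isolated leaf `a` as a sibling of `b`. -/
def attach (G : XForest X) (a b : X) (hab : a ≠ b) (ha : {a} ∈ G.components) : XForest X where
  clusters := insert {b} (G.clusters.image (phi a b))
  nonempty_of_mem := by
    intro s hs
    rcases Finset.mem_insert.mp hs with rfl | hs
    · exact Finset.singleton_nonempty b
    · obtain ⟨t, ht, rfl⟩ := Finset.mem_image.mp hs
      exact (G.nonempty_of_mem t ht).mono (subset_phi _ _ _)
  laminar := by
    have hb : ∀ s : Finset X, ¬ Disjoint {b} s → {b} ⊆ s := by
      intro s h; simpa using h
    have key : ∀ s ∈ G.clusters, ∀ t ∈ G.clusters, b ∈ s → b ∉ t →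
        ¬ Disjoint (phi a b s) (phi a b t) → phi a b t ⊆ phi a b s := by
      intro s hs t ht hbs hbt h
      rw [phi_mem hbs, phi_not hbt] at *
      obtain ⟨x, hx, hx'⟩ := Finset.not_disjoint_iff.mp h
      rcases Finset.mem_insert.mp hx with rfl | hx
      · have := sub_comp ha ht (Finset.mem_singleton_self x) hx'
        exact this.trans (by simp)
      · rcases lam hs ht hx hx' with h | h
        · exact absurd (h hbs) hbt
        · exact h.trans (Finset.subset_insert _ _)
    intro s hs t ht h
    rcases Finset.mem_insert.mp hs with rfl | hs
    · exact Or.inl (hb t h)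
    rcases Finset.mem_insert.mp ht with rfl | ht
    · exact Or.inr (hb s fun h' => h h'.symm)
    obtain ⟨s, hs', rfl⟩ := Finset.mem_image.mp hs
    obtain ⟨t, ht', rfl⟩ := Finset.mem_image.mp ht
    have fin : ∀ s ∈ G.clusters, ∀ t ∈ G.clusters, ¬ Disjoint (phi a b s) (phi a b t) →
        phi a b s ⊆ phi a b t ∨ phi a b t ⊆ phi a b s := by
      intro s hs t ht h
      by_cases hbs : b ∈ s
      · by_cases hbt : b ∈ t
        · exact (lam hs ht hbs hbt).imp (phi_mono a b) (phi_mono a b)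
        · exact Or.inr (key s hs t ht hbs hbt h)
      · by_cases hbt : b ∈ t
        · exact Or.inl (key t ht s hs hbt hbs fun h' => h h'.symm)
        · have h' := h
          rw [phi_not hbs, phi_not hbt] at h'
          exact (G.laminar s hs t ht h').imp (phi_mono a b) (phi_mono a b)
    exact fin s hs' t ht' h
  singleton_mem := by
    intro x
    by_cases hx : x = b
    · subst hx; exact Finset.mem_insert_self _ _
    · refine Finset.mem_insert_of_mem (Finset.mem_image.mpr ⟨{x}, G.singleton_mem x, ?_⟩)
      exact phi_not (by simpa using Ne.symm hx)

section attach

variable {G : XForest X} {a b : X} (hab : a ≠ b) (ha : {a} ∈ G.components)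

theorem mem_attach {t : Finset X} : t ∈ (attach G a b hab ha).clusters ↔
    t = {b} ∨ ∃ s ∈ G.clusters, t = phi a b s := by
  change t ∈ insert {b} (G.clusters.image (phi a b)) ↔ _
  simp only [Finset.mem_insert, Finset.mem_image, eq_comm]

theorem not_mem_comp (ha : {a} ∈ G.components) {C : Finset X} (hC : C ∈ G.components)
    (hne : C ≠ {a}) : a ∉ C :=
  fun h => hne (comp_eq hC ha h (Finset.mem_singleton_self a))

theorem pair_mem_attach : {a, b} ∈ (attach G a b hab ha).clusters :=
  (mem_attach hab ha).mpr (Or.inr ⟨{b}, G.singleton_mem b, (phi_mem (by simp)).symm⟩)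

theorem comp_attach {C' : Finset X} : C' ∈ (attach G a b hab ha).components ↔
    ∃ C ∈ G.components, C ≠ {a} ∧ C' = phi a b C := by
  constructor
  · intro h
    rcases (mem_attach hab ha).mp (comp_mem h) with rfl | ⟨s, hs, rfl⟩
    · have := comp_max h (pair_mem_attach hab ha) (by simp)
      have : a ∈ ({b} : Finset X) := by rw [this]; simp
      exact absurd (Finset.mem_singleton.mp this) hab
    · obtain ⟨C, hC, hsC⟩ := exists_comp hs
      refine ⟨C, hC, ?_, comp_max h ((mem_attach hab ha).mpr (Or.inr ⟨C, comp_mem hC, rfl⟩))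
        (phi_mono a b hsC)⟩
      rintro rfl
      have hbs : b ∉ s := fun h => hab (Finset.mem_singleton.mp (hsC h)).symm
      have e := comp_max h (pair_mem_attach hab ha)
        (by rw [phi_not hbs]; exact hsC.trans (by simp))
      rw [phi_not hbs] at e
      exact hbs (by rw [e]; simp)
  · rintro ⟨C, hC, hne, rfl⟩
    have haC := not_mem_comp ha hC hne
    refine mem_comp ((mem_attach hab ha).mpr (Or.inr ⟨C, comp_mem hC, rfl⟩)) ?_
    intro t ht hsub
    rcases (mem_attach hab ha).mp ht with rfl | ⟨s, hs, rfl⟩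
    · have h1 := (subset_phi a b C).trans hsub
      obtain ⟨x, hx⟩ := G.nonempty_of_mem C (comp_mem hC)
      have := Finset.mem_singleton.mp (h1 hx)
      subst this
      simpa using subset_phi a x C hx
    · have hCs : C ⊆ s := by
        intro x hx
        have h1 := hsub (subset_phi a b C hx)
        by_cases hb : b ∈ s
        · rw [phi_mem hb] at h1
          rcases Finset.mem_insert.mp h1 with rfl | h1
          · exact absurd hx haC
          · exact h1
        · rwa [phi_not hb] at h1
      rw [comp_max hC hs hCs]

theorem ord_attach : (attach G a b hab ha).ord + 1 ≤ G.ord := by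
  have h : (attach G a b hab ha).components ⊆ (G.components.erase {a}).image (phi a b) := by
    intro C hC
    obtain ⟨D, hD, hne, rfl⟩ := (comp_attach hab ha).mp hC
    exact Finset.mem_image.mpr ⟨D, Finset.mem_erase.mpr ⟨hne, hD⟩, rfl⟩
  have h1 := (Finset.card_le_card h).trans Finset.card_image_le
  have h2 := Finset.card_erase_add_one ha
  unfold XForest.ord
  omega

end attach

/-- The local structure around `a` and `b`. -/
structure Loc (F : XForest X) (a b : X) (d : Finset X) : Prop where
  lmem : insert a (insert b d) ∈ F.clusters
  na : a ∉ d
  nb : b ∉ d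
  dmem : d.Nonempty → d ∈ F.clusters
  least : ∀ s ∈ F.clusters, a ∈ s → b ∈ s → insert a (insert b d) ⊆ s

theorem attach_sub {G F : XForest X} {a b : X} (hab : a ≠ b) (ha : {a} ∈ G.components)
    {d : Finset X} (hL : Loc F a b d) (hG : Sub G F)
    (hcr : ∀ C ∈ G.components, (C ∩ d).Nonempty → C ⊆ d) :
    Sub (attach G a b hab ha) F := by
  set l : Finset X := insert a (insert b d) with hl
  have hal : a ∈ l := by simp [hl]
  have hbl : b ∈ l := by simp [hl]
  have hdl : d ⊆ l := fun x hx => by simp [hl, hx]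
  have hlm : ∀ x, x ∈ l ↔ x = a ∨ x = b ∨ x ∈ d := fun x => by simp [hl]
  -- components containing `b` avoid `d`
  have hbd : ∀ C ∈ G.components, b ∈ C → ∀ x ∈ C, x ∉ d := by
    intro C hC hbC x hx hxd
    exact hL.nb (hcr C hC ⟨x, Finset.mem_inter.mpr ⟨hx, hxd⟩⟩ hbC)
  -- trichotomy
  have tri : ∀ s ∈ F.clusters, (a ∈ s ∨ b ∈ s) → l ⊆ s ∨ (s ⊆ l ∧ ¬ (a ∈ s ∧ b ∈ s)) := by
    intro s hs hor
    have h : s ⊆ l ∨ l ⊆ s := by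
      rcases hor with h | h
      · exact lam hs hL.lmem h hal
      · exact lam hs hL.lmem h hbl
    by_cases h2 : l ⊆ s
    · exact Or.inl h2
    · exact Or.inr ⟨h.resolve_right h2, fun h3 => h2 (hL.least s hs h3.1 h3.2)⟩
  have hsd : ∀ s ∈ F.clusters, (a ∈ s ∨ b ∈ s) → ∀ x ∈ s, x ∈ d → d ⊂ s := by
    intro s hs hor x hxs hxd
    rcases lam' (hL.dmem ⟨x, hxd⟩) hs hxd hxs with h | h
    · exact h
    · rcases hor with h' | h'
      · exact absurd (h h') hL.na
      · exact absurd (h h') hL.nb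
  -- main case of disjointness
  have main : ∀ C ∈ G.components, ∀ D ∈ G.components, C ≠ D → a ∉ D → b ∈ C →
      ∀ s ∈ F.clusters, (insert a C ∩ s).Nonempty → (D ∩ s).Nonempty →
      ∃ t ∈ F.clusters, t ⊂ s ∧ (insert a C ⊆ t ∨ D ⊆ t) := by
    intro C hC D hD hne haD hbC s hs hCs ⟨y, hy⟩
    rw [Finset.mem_inter] at hy
    have hbD : b ∉ D := fun h => hne (comp_eq hC hD hbC h)
    by_cases hor : a ∈ s ∨ b ∈ s
    · by_cases hDd : (D ∩ d).Nonempty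
      · have hDsub := hcr D hD hDd
        have hyd := hDsub hy.1
        exact ⟨d, hL.dmem ⟨y, hyd⟩, hsd s hs hor y hy.2 hyd, Or.inr hDsub⟩
      · have hyl : y ∉ l := by
          rw [hlm]
          rintro (rfl | rfl | h)
          · exact haD hy.1
          · exact hbD hy.1
          · exact hDd ⟨y, Finset.mem_inter.mpr ⟨hy.1, h⟩⟩
        have hls : l ⊆ s := by
          rcases tri s hs hor with h | h
          · exact h
          · exact absurd (h.1 hy.2) hyl
        have hls' : l ⊂ s := ⟨hls, fun h => hyl (h hy.2)⟩
        obtain ⟨t, ht, hts, h | h⟩ := hG.disj C hC D hD hne s hs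
          ⟨b, Finset.mem_inter.mpr ⟨hbC, hls hbl⟩⟩ ⟨y, Finset.mem_inter.mpr hy⟩
        · rcases tri t ht (Or.inr (h hbC)) with h' | h'
          · exact ⟨t, ht, hts, Or.inl (Finset.insert_subset (h' hal) h)⟩
          · exact ⟨l, hL.lmem, hls', Or.inl (Finset.insert_subset hal (h.trans h'.1))⟩
        · exact ⟨t, ht, hts, Or.inr h⟩
    · push Not at hor
      obtain ⟨x, hx⟩ := hCs
      rw [Finset.mem_inter, Finset.mem_insert] at hx
      have hxC : x ∈ C := by
        rcases hx.1 with rfl | h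
        · exact absurd hx.2 hor.1
        · exact h
      obtain ⟨t, ht, hts, h | h⟩ := hG.disj C hC D hD hne s hs
          ⟨x, Finset.mem_inter.mpr ⟨hxC, hx.2⟩⟩ ⟨y, Finset.mem_inter.mpr hy⟩
      · exact absurd (hts.1 (h hbC)) hor.2
      · exact ⟨t, ht, hts, Or.inr h⟩
  have sing : ∀ x, ∃ C ∈ (attach G a b hab ha).components, ∃ s ∈ F.clusters,
      ({x} : Finset X) = C ∩ s := by
    intro x
    obtain ⟨C, hC, hx⟩ := exists_comp' (attach G a b hab ha) x
    refine ⟨C, hC, {x}, F.singleton_mem x, ?_⟩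
    rw [eq_comm, Finset.inter_eq_right]
    simpa using hx
  refine ⟨?_, ?_, ?_⟩
  · intro C' hC' D' hD' hne s hs hCs hDs
    obtain ⟨C, hC, hCa, rfl⟩ := (comp_attach hab ha).mp hC'
    obtain ⟨D, hD, hDa, rfl⟩ := (comp_attach hab ha).mp hD'
    have hne' : C ≠ D := fun h => hne (by rw [h])
    by_cases hbC : b ∈ C
    · have hbD : b ∉ D := fun h => hne' (comp_eq hC hD hbC h)
      rw [phi_mem hbC] at *
      rw [phi_not hbD] at *
      exact main C hC D hD hne' (not_mem_comp ha hD hDa) hbC s hs hCs hDs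
    · rw [phi_not hbC] at *
      by_cases hbD : b ∈ D
      · rw [phi_mem hbD] at *
        obtain ⟨t, ht, hts, h⟩ :=
          main D hD C hC hne'.symm (not_mem_comp ha hC hCa) hbD s hs hDs hCs
        exact ⟨t, ht, hts, h.symm⟩
      · rw [phi_not hbD] at *
        exact hG.disj C hC D hD hne' s hs hCs hDs
  · intro t ht
    rcases (mem_attach hab ha).mp ht with rfl | ⟨s1, hs1, rfl⟩
    · exact sing b
    obtain ⟨C, hC, s, hs, rfl⟩ := hG.down s1 hs1
    obtain ⟨x, hx⟩ := G.nonempty_of_mem _ hs1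
    rw [Finset.mem_inter] at hx
    by_cases hCa : C = {a}
    · subst hCa
      have hxa := Finset.mem_singleton.mp hx.1
      subst hxa
      have e : ({x} : Finset X) ∩ s = {x} := by
        rw [Finset.inter_eq_left]; simpa using hx.2
      rw [e, phi_not (by simpa using Ne.symm hab)]
      exact sing x
    have haC := not_mem_comp ha hC hCa
    have hcomp := (comp_attach hab ha).mpr ⟨C, hC, hCa, rfl⟩
    by_cases hbC : b ∈ C
    · by_cases hbs : b ∈ s
      · rw [phi_mem (Finset.mem_inter.mpr ⟨hbC, hbs⟩)]
        by_cases has : a ∈ s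
        · refine ⟨_, hcomp, s, hs, ?_⟩
          rw [phi_mem hbC]
          ext y
          simp only [Finset.mem_insert, Finset.mem_inter]
          constructor
          · rintro (rfl | h)
            · exact ⟨Or.inl rfl, has⟩
            · exact ⟨Or.inr h.1, h.2⟩
          · rintro ⟨rfl | h, h'⟩
            · exact Or.inl rfl
            · exact Or.inr ⟨h, h'⟩
        · refine ⟨_, hcomp, l, hL.lmem, ?_⟩
          have hsl : s ⊆ l := by
            rcases tri s hs (Or.inr hbs) with h | h
            · exact absurd (h hal) has
            · exact h.1
          rw [phi_mem hbC]
          ext y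
          simp only [Finset.mem_insert, Finset.mem_inter]
          constructor
          · rintro (rfl | h)
            · exact ⟨Or.inl rfl, hal⟩
            · exact ⟨Or.inr h.1, hsl h.2⟩
          · rintro ⟨rfl | h, h'⟩
            · exact Or.inl rfl
            · rcases (hlm y).mp h' with rfl | rfl | h''
              · exact Or.inl rfl
              · exact Or.inr ⟨h, hbs⟩
              · exact absurd h'' (hbd C hC hbC y h)
      · rw [phi_not (fun h => hbs (Finset.mem_inter.mp h).2)]
        by_cases has : a ∈ s
        · exfalso
          rcases tri s hs (Or.inl has) with h | h
          · exact hbs (h hbl)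
          · rcases (hlm x).mp (h.1 hx.2) with rfl | rfl | h'
            · exact haC hx.1
            · exact hbs hx.2
            · exact hbd C hC hbC x hx.1 h'
        · refine ⟨_, hcomp, s, hs, ?_⟩
          rw [phi_mem hbC, Finset.insert_inter_of_notMem has]
    · rw [phi_not (fun h => hbC (Finset.mem_inter.mp h).1)]
      refine ⟨_, hcomp, s, hs, ?_⟩
      rw [phi_not hbC]
  · intro C' hC' s hs hne
    obtain ⟨C, hC, hCa, rfl⟩ := (comp_attach hab ha).mp hC'
    have haC := not_mem_comp ha hC hCa
    by_cases hbC : b ∈ C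
    · rw [phi_mem hbC] at *
      by_cases hor : a ∈ s ∨ b ∈ s
      · rcases tri s hs hor with h | h
        · refine (mem_attach hab ha).mpr (Or.inr ⟨C ∩ s, hG.up C hC s hs
            ⟨b, Finset.mem_inter.mpr ⟨hbC, h hbl⟩⟩, ?_⟩)
          rw [phi_mem (Finset.mem_inter.mpr ⟨hbC, h hbl⟩), Finset.insert_inter_of_mem (h hal)]
        · have hy : ∀ y ∈ insert a C ∩ s, y = a ∨ y = b := by
            intro y hy
            rw [Finset.mem_inter, Finset.mem_insert] at hy
            rcases hy.1 with h1 | h1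
            · exact Or.inl h1
            · rcases (hlm y).mp (h.1 hy.2) with h2 | h2 | h2
              · exact Or.inl h2
              · exact Or.inr h2
              · exact absurd h2 (hbd C hC hbC y h1)
          obtain ⟨x, hx⟩ := hne
          have : insert a C ∩ s = {x} := by
            refine Finset.eq_singleton_iff_unique_mem.mpr ⟨hx, fun y hy' => ?_⟩
            have hxs := (Finset.mem_inter.mp hx).2
            have hys := (Finset.mem_inter.mp hy').2
            rcases hy x hx with rfl | rfl <;> rcases hy y hy' with rfl | rfl
            · rfl
            · exact absurd ⟨hxs, hys⟩ h.2
            · exact absurd ⟨hys, hxs⟩ h.2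
            · rfl
          rw [this]
          exact (attach G a b hab ha).singleton_mem x
      · push Not at hor
        rw [Finset.insert_inter_of_notMem hor.1] at *
        exact (mem_attach hab ha).mpr (Or.inr ⟨C ∩ s, hG.up C hC s hs hne,
          (phi_not fun h => hor.2 (Finset.mem_inter.mp h).2).symm⟩)
    · rw [phi_not hbC] at *
      exact (mem_attach hab ha).mpr (Or.inr ⟨C ∩ s, hG.up C hC s hs hne,
          (phi_not fun h => hbC (Finset.mem_inter.mp h).1).symm⟩)

theorem comp_cut {G : XForest X} {Z v : Finset X} (hZ : Z ∈ G.components)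
    (hv : v ∈ G.clusters) (hvZ : v ⊂ Z) {C : Finset X} (hC : C ∈ (G.cut {v}).components) :
    (C ∈ G.components ∧ C ≠ Z) ∨ C = v ∨ C = Z \ v := by
  have hD : ({v} : Finset (Finset X)) ⊆ G.clusters := by simpa using hv
  have hm := fun t => mem_cut (F := G) hD (t := t)
  simp only [Finset.mem_singleton, forall_eq] at hm
  obtain ⟨⟨x, hx⟩, s, hs, hCs⟩ := (hm C).mp (comp_mem hC)
  obtain ⟨C0, hC0, hsC0⟩ := exists_comp hs
  have hCC0 : C ⊆ C0 := fun y hy => hsC0 ((hCs y).mp hy).1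
  by_cases h0 : C0 = Z
  · subst h0
    right
    have hvm : v ∈ (G.cut {v}).clusters := (hm v).mpr
      ⟨G.nonempty_of_mem v hv, v, hv, fun y => ⟨fun h => ⟨h, fun h' => absurd h' (by simp)⟩,
        fun h => h.1⟩⟩
    obtain ⟨z, hz, hzv⟩ := Finset.exists_of_ssubset hvZ
    have hrm : C0 \ v ∈ (G.cut {v}).clusters := (hm _).mpr
      ⟨⟨z, Finset.mem_sdiff.mpr ⟨hz, hzv⟩⟩, C0, comp_mem hC0, fun y => by
        rw [Finset.mem_sdiff]; exact ⟨fun h => ⟨h.1, fun _ => h.2⟩, fun h => ⟨h.1, h.2 hvZ⟩⟩⟩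
    by_cases hxv : ∃ x ∈ C, x ∈ v
    · left
      obtain ⟨x, hx, hxv⟩ := hxv
      have h1 := sub_comp hC hvm hx hxv
      refine Finset.Subset.antisymm ?_ h1
      rcases lam' hv hs hxv ((hCs x).mp hx).1 with h | h
      · exact absurd hxv (((hCs x).mp hx).2 h)
      · exact fun y hy => h ((hCs y).mp hy).1
    · right
      push Not at hxv
      exact comp_max hC hrm fun y hy => Finset.mem_sdiff.mpr ⟨hCC0 hy, hxv y hy⟩
  · left
    have hm0 : C0 ∈ (G.cut {v}).clusters := by
      refine (hm C0).mpr ⟨G.nonempty_of_mem _ (comp_mem hC0), C0, comp_mem hC0, fun y => ?_⟩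
      refine ⟨fun h => ⟨h, fun h' hyv => ?_⟩, fun h => h.1⟩
      exact h0 (comp_eq hC0 hZ h (hvZ.1 hyv))
    have := comp_max hC hm0 hCC0
    subst this
    exact ⟨hC0, h0⟩

theorem core {m : ℕ} (Fs : Fin m → XForest X) {G : XForest X} (hG : IsHMAF Fs G)
    {a b : X} (hab : a ≠ b) (ha : {a} ∈ G.components) {d : Finset X}
    (hd : d.Nonempty → ∃ i, Loc (Fs i) a b d)
    (hL : ∀ i, Loc (Fs i) a b ∅ ∨ Loc (Fs i) a b d) :
    ∃ G' : XForest X, IsHMAF Fs G' ∧ {a, b} ∈ G'.clusters := by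
  have hGs : ∀ i, Sub G (Fs i) := fun i => sub_of_isSubforest (hG.1 i)
  suffices h : ∃ G1 : XForest X, (∀ i, Sub G1 (Fs i)) ∧ G1.ord ≤ G.ord + 1 ∧
      {a} ∈ G1.components ∧ ∀ C ∈ G1.components, (C ∩ d).Nonempty → C ⊆ d by
    obtain ⟨G1, h1, h2, h3, h4⟩ := h
    refine ⟨attach G1 a b hab h3, ⟨fun i => isSubforest_of_sub ?_, fun G' hG' => ?_⟩,
      pair_mem_attach hab h3⟩
    · rcases hL i with h | h
      · exact attach_sub hab h3 h (h1 i) (by simp)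
      · exact attach_sub hab h3 h (h1 i) h4
    · have e1 := hG.2 G' hG'
      have e2 := ord_attach hab h3
      omega
  by_cases hcr : ∀ C ∈ G.components, (C ∩ d).Nonempty → C ⊆ d
  · exact ⟨G, hGs, by omega, ha, hcr⟩
  push Not at hcr
  obtain ⟨Z, hZ, hZd, hZn⟩ := hcr
  obtain ⟨i0, hi0⟩ := hd (hZd.mono Finset.inter_subset_right)
  have hdF := hi0.dmem (hZd.mono Finset.inter_subset_right)
  have hv := (hGs i0).up Z hZ d hdF hZd
  have hvZ : Z ∩ d ⊂ Z := ⟨Finset.inter_subset_left, fun h => hZn fun x hx =>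
    (Finset.mem_inter.mp (h hx)).2⟩
  have hsub : Sub (G.cut {Z ∩ d}) G :=
    sub_of_isSubforest ⟨{Z ∩ d}, by simpa using hv, rfl⟩
  refine ⟨G.cut {Z ∩ d}, fun i => hsub.trans (hGs i), ?_, ?_, ?_⟩
  · have h : (G.cut {Z ∩ d}).components ⊆ insert (Z ∩ d) (insert (Z \ (Z ∩ d))
        (G.components.erase Z)) := by
      intro C hC
      rcases comp_cut hZ hv hvZ hC with h | h | h
      · simp [h.1, h.2]
      · simp [h]
      · rw [h]; simp
    have e1 := Finset.card_le_card h
    have e2 := Finset.card_insert_le (Z ∩ d) (insert (Z \ (Z ∩ d)) (G.components.erase Z))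
    have e3 := Finset.card_insert_le (Z \ (Z ∩ d)) (G.components.erase Z)
    have e4 := Finset.card_erase_add_one hZ
    unfold XForest.ord
    omega
  · refine mem_comp (XForest.singleton_mem _ a) fun t ht hat => ?_
    obtain ⟨C, hC, s, hs, rfl⟩ := hsub.down t ht
    have := sub_comp ha hs (Finset.mem_singleton_self a)
      (Finset.mem_inter.mp (hat (Finset.mem_singleton_self a))).2
    exact Finset.inter_subset_right.trans this
  · intro C hC hCd
    rcases comp_cut hZ hv hvZ hC with ⟨h1, h2⟩ | h | h
    · obtain ⟨t, ht, htd, h | h⟩ := (hGs i0).disj C h1 Z hZ h2 d hdF hCd hZd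
      · exact h.trans htd.1
      · exact absurd (h.trans htd.1) hZn
    · rw [h]; exact Finset.inter_subset_right
    · exfalso
      obtain ⟨x, hx⟩ := hCd
      rw [h] at hx
      simp only [Finset.mem_inter, Finset.mem_sdiff] at hx
      tauto

theorem lca_spec {F : XForest X} {a b : X} (h : ∃ s ∈ F.clusters, a ∈ s ∧ b ∈ s) :
    F.lca2 a b ∈ F.clusters ∧ a ∈ F.lca2 a b ∧ b ∈ F.lca2 a b ∧
      ∀ s ∈ F.clusters, a ∈ s → b ∈ s → F.lca2 a b ⊆ s := by
  obtain ⟨s, hs, has, hbs⟩ := h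
  obtain ⟨l, hl, hab, hmin⟩ := exists_lca (F := F) (C := {a, b})
    ⟨s, hs, by intro x hx; simp at hx; rcases hx with rfl | rfl <;> assumption⟩
  have hal : a ∈ l := hab (by simp)
  have hbl : b ∈ l := hab (by simp)
  have hle : ∀ s ∈ F.clusters, a ∈ s → b ∈ s → l ⊆ s := by
    intro s hs has hbs
    rcases lam' hs hl has hal with h | h
    · refine absurd ?_ (hmin s hs h)
      intro x hx; simp at hx; rcases hx with rfl | rfl <;> assumption
    · exact h
  have e : F.lca2 a b = l := by
    apply le_antisymm
    · exact Finset.inf_le (f := id) (Finset.mem_filter.mpr ⟨hl, hal, hbl⟩)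
    · refine Finset.le_inf fun t ht => ?_
      obtain ⟨h1, h2, h3⟩ := Finset.mem_filter.mp ht
      exact hle t h1 h2 h3
  rw [e]
  exact ⟨hl, hal, hbl, hle⟩

theorem exists_edge {F : XForest X} {a b x : X} (h : ∃ s ∈ F.clusters, a ∈ s ∧ b ∈ s)
    (hx : x ∈ F.lca2 a b) (hxa : x ≠ a) (hxb : x ≠ b) :
    ∃ e ∈ F.Eset a b, e ∈ F.clusters ∧ x ∈ e ∧ a ∉ e ∧ b ∉ e ∧ e ⊆ F.lca2 a b := by
  obtain ⟨hl, hal, hbl, hle⟩ := lca_spec h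
  set l := F.lca2 a b with hldef
  obtain ⟨e, he, hmax⟩ := (F.clusters.filter fun t => x ∈ t ∧ a ∉ t ∧ b ∉ t).exists_max_image
    Finset.card ⟨{x}, Finset.mem_filter.mpr ⟨F.singleton_mem x, by simp, by simpa using hxa.symm,
      by simpa using hxb.symm⟩⟩
  obtain ⟨heF, hxe, hae, hbe⟩ := Finset.mem_filter.mp he
  have hel : e ⊂ l := by
    rcases lam' heF hl hxe hx with h | h
    · exact h
    · exact absurd (h hal) hae
  refine ⟨e, ?_, heF, hxe, hae, hbe, hel.1⟩
  obtain ⟨p, hp, hpmin⟩ := (F.clusters.filter fun t => e ⊂ t).exists_min_image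
    Finset.card ⟨l, Finset.mem_filter.mpr ⟨hl, hel⟩⟩
  obtain ⟨hpF, hep⟩ := Finset.mem_filter.mp hp
  have hchild : F.IsChild e p := by
    refine ⟨heF, hpF, hep, fun t ht het htp => ?_⟩
    have := hpmin t (Finset.mem_filter.mpr ⟨ht, het⟩)
    exact absurd (Finset.card_lt_card htp) (by omega)
  have hxp : x ∈ p := hep.1 hxe
  have hpab : a ∈ p ∨ b ∈ p := by
    by_contra hcon
    push Not at hcon
    have := hmax p (Finset.mem_filter.mpr ⟨hpF, hxp, hcon⟩)
    exact absurd (Finset.card_lt_card hep) (by omega)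
  have hpl : p ⊆ l := by
    rcases lam' hl hpF hx hxp with h | h
    · exact absurd h (hchild.2.2.2 l hl hel)
    · exact h
  refine Finset.mem_union.mpr ?_
  by_cases hpe : p = l
  · right
    unfold XForest.E2
    classical
    rw [Finset.mem_filter]
    refine ⟨heF, ?_, hae, hbe⟩
    rw [← hldef, ← hpe]; exact hchild
  · left
    unfold XForest.E1
    classical
    rw [Finset.mem_filter]
    refine ⟨heF, p, hpF, hchild, Finset.ssubset_iff_subset_ne.mpr
      ⟨hpl, hpe⟩, ?_⟩
    rcases hpab with h | h
    · refine Or.inl ⟨h, fun h' => ?_, hae⟩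
      rw [h'] at hxp
      exact hxa (Finset.mem_singleton.mp hxp)
    · refine Or.inr ⟨h, fun h' => ?_, hbe⟩
      rw [h'] at hxp
      exact hxb (Finset.mem_singleton.mp hxp)

theorem Loc.of_pair {F : XForest X} {a b : X} (h : {a, b} ∈ F.clusters) : Loc F a b ∅ := by
  refine ⟨by simpa using h, by simp, by simp, by simp, ?_⟩
  intro s _ h1 h2 x hx
  simp at hx
  rcases hx with rfl | rfl <;> assumption

theorem Loc.symm {F : XForest X} {a b : X} {d : Finset X} (h : Loc F a b d) : Loc F b a d := by
  have e : insert b (insert a d) = insert a (insert b d) := Finset.insert_comm _ _ _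
  refine ⟨by rw [e]; exact h.lmem, h.nb, h.na, h.dmem, ?_⟩
  intro s hs h1 h2
  rw [e]; exact h.least s hs h2 h1

theorem loc_of_small {F : XForest X} {a b : X} (h : ∃ s ∈ F.clusters, a ∈ s ∧ b ∈ s)
    (hc : (F.Eset a b).card ≤ 1) :
    Loc F a b ∅ ∨ ((F.Eset a b).card = 1 ∧ (F.lca2 a b \ {a, b}).Nonempty ∧
      Loc F a b (F.lca2 a b \ {a, b})) := by
  obtain ⟨hl, hal, hbl, hle⟩ := lca_spec h
  have hins : insert a (insert b (F.lca2 a b \ {a, b})) = F.lca2 a b := by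
    ext y
    simp only [Finset.mem_insert, Finset.mem_sdiff, Finset.mem_singleton]
    constructor
    · rintro (rfl | rfl | h) <;> [exact hal; exact hbl; exact h.1]
    · intro hy; tauto
  by_cases hR : (F.lca2 a b \ {a, b}).Nonempty
  · right
    have hR' := hR
    obtain ⟨x, hx⟩ := hR'
    simp only [Finset.mem_insert, Finset.mem_sdiff, Finset.mem_singleton, not_or] at hx
    obtain ⟨e, he, heF, hxe, hae, hbe, hel⟩ := exists_edge h hx.1 hx.2.1 hx.2.2
    have heR : F.lca2 a b \ {a, b} = e := by
      ext y
      simp only [Finset.mem_insert, Finset.mem_sdiff, Finset.mem_singleton, not_or]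
      constructor
      · rintro ⟨h1, h2, h3⟩
        obtain ⟨e', he', -, hye, -⟩ := exists_edge h h1 h2 h3
        rwa [Finset.card_le_one.mp hc e he e' he']
      · intro hy
        exact ⟨hel hy, fun h => hae (h ▸ hy), fun h => hbe (h ▸ hy)⟩
    refine ⟨le_antisymm hc (Finset.card_pos.mpr ⟨e, he⟩), hR, ?_, by simp, by simp, ?_, ?_⟩
    · rw [hins]; exact hl
    · rw [heR]; exact fun _ => heF
    · rw [hins]; exact hle
  · left
    rw [Finset.not_nonempty_iff_eq_empty] at hR
    rw [hR] at hins
    apply Loc.of_pair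
    have : ({a, b} : Finset X) = F.lca2 a b := hins
    rw [this]; exact hl

theorem isMSS_of_mem {G : XForest X} {a b : X} (hab : a ≠ b) (h : {a, b} ∈ G.clusters) :
    G.IsMSS {a, b} := by
  have h2 := Finset.card_pair hab
  refine ⟨h, by omega, fun c hc hss => ?_⟩
  have h3 := Finset.card_lt_card hss
  have h4 := Finset.card_pos.mpr (G.nonempty_of_mem c hc)
  omega

end HMafAux

/-- Lemma 4.4, Case 2.2.1.  Let `(F_1, …, F_m; k)` satisfy
the label-set isomorphism property with `{a,b}` a minimum MSS lying in `F_1`,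
suppose `|E_{F_i}(a,b)| ≤ 1` for all `2 ≤ i ≤ m`, the collection `𝒞` of
forests `F` with `|E_F(a,b)| = 1` is nonempty, and
`L(lca_F(a,b)) = L(lca_{F'}(a,b))` for all `F, F' ∈ 𝒞`.  Then there is a hard
maximum agreement forest for the forests of the instance in which `a` and `b`
are a sibling-pair. -/
theorem statement_11 {X : Type*} [DecidableEq X] [Fintype X] {m : ℕ} (hm : 0 < m)
    (I : Inst X m) (a b : X) (hab : a ≠ b)
    (hiso : InstLabelIso I)
    (hMSS : I.MinMSS ⟨0, hm⟩ {a, b})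
    (hsmall : ∀ i : Fin m, i ≠ ⟨0, hm⟩ → ((I.F i).Eset a b).card ≤ 1)
    (hCne : ∃ i : Fin m, ((I.F i).Eset a b).card = 1)
    (hlca : ∀ i j : Fin m, ((I.F i).Eset a b).card = 1 →
      ((I.F j).Eset a b).card = 1 → (I.F i).lca2 a b = (I.F j).lca2 a b) :
    ∃ G : XForest X, IsHMAF I.F G ∧ G.IsMSS {a, b} := by
  classical
  have hpair : {a, b} ∈ (I.F ⟨0, hm⟩).clusters := hMSS.1.1
  have hsame : ∀ i, ∃ s ∈ (I.F i).clusters, a ∈ s ∧ b ∈ s := by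
    intro i
    obtain ⟨C, hC, hs⟩ := HMafAux.exists_comp hpair
    have hC' : C ∈ (I.F i).components := by
      have := hiso ⟨0, hm⟩ i
      unfold LabelIso at this
      rwa [← this]
    exact ⟨C, HMafAux.comp_mem hC', hs (by simp), hs (by simp)⟩
  have hloc : ∀ i, HMafAux.Loc (I.F i) a b ∅ ∨ (((I.F i).Eset a b).card = 1 ∧
      ((I.F i).lca2 a b \ {a, b}).Nonempty ∧
      HMafAux.Loc (I.F i) a b ((I.F i).lca2 a b \ {a, b})) := by
    intro i
    by_cases hi : i = ⟨0, hm⟩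
    · left; rw [hi]; exact HMafAux.Loc.of_pair hpair
    · exact HMafAux.loc_of_small (hsame i) (hsmall i hi)
  have hdex : ∃ d : Finset X, (d.Nonempty → ∃ i, HMafAux.Loc (I.F i) a b d) ∧
      ∀ i, HMafAux.Loc (I.F i) a b ∅ ∨ HMafAux.Loc (I.F i) a b d := by
    by_cases hall : ∀ i, HMafAux.Loc (I.F i) a b ∅
    · exact ⟨∅, by simp, fun i => Or.inl (hall i)⟩
    · push Not at hall
      obtain ⟨i0, hi0⟩ := hall
      have h0 := (hloc i0).resolve_left hi0
      refine ⟨(I.F i0).lca2 a b \ {a, b}, fun _ => ⟨i0, h0.2.2⟩, fun i => ?_⟩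
      rcases hloc i with h | h
      · exact Or.inl h
      · right
        rw [hlca i0 i h0.1 h.1]
        exact h.2.2
  obtain ⟨d, hd1, hd2⟩ := hdex
  obtain ⟨G, hG⟩ := HMafAux.exists_hmaf I.F
  have hs0 := HMafAux.sub_of_isSubforest (hG.1 ⟨0, hm⟩)
  obtain ⟨A, hA, haA⟩ := HMafAux.exists_comp' G a
  obtain ⟨B, hB, hbB⟩ := HMafAux.exists_comp' G b
  have hsing : ∀ (C t : Finset X) (x : X), (x = a ∨ x = b) → x ∈ C → C ⊆ t → t ⊂ {a, b} →
      C = {x} := by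
    intro C t x hx hxC hCt ht
    have h1 := Finset.card_lt_card (lt_of_le_of_lt hCt ht)
    rw [Finset.card_pair hab] at h1
    exact (Finset.eq_of_subset_of_card_le (by simpa using hxC)
      (by rw [Finset.card_singleton]; omega)).symm
  by_cases hAB : A = B
  · subst hAB
    have hsub : ({a, b} : Finset X) ⊆ A := by
      intro x hx; simp at hx; rcases hx with rfl | rfl <;> assumption
    have := hs0.up A hA {a, b} hpair ⟨a, by simp [haA]⟩
    rw [Finset.inter_eq_right.mpr hsub] at this
    exact ⟨G, hG, HMafAux.isMSS_of_mem hab this⟩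
  · obtain ⟨t, ht, hts, h | h⟩ := hs0.disj A hA B hB hAB {a, b} hpair
      ⟨a, by simp [haA]⟩ ⟨b, by simp [hbB]⟩
    · have e := hsing A t a (Or.inl rfl) haA h hts
      subst e
      obtain ⟨G', h1, h2⟩ := HMafAux.core I.F hG hab hA hd1 hd2
      exact ⟨G', h1, HMafAux.isMSS_of_mem hab h2⟩
    · have e := hsing B t b (Or.inr rfl) hbB h hts
      subst e
      obtain ⟨G', h1, h2⟩ := HMafAux.core I.F hG hab.symm hB
        (fun h => (hd1 h).imp fun i hi => hi.symm)
        (fun i => (hd2 i).imp HMafAux.Loc.symm HMafAux.Loc.symm)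
      rw [Finset.pair_comm] at h2
      exact ⟨G', h1, HMafAux.isMSS_of_mem hab h2⟩
end

section
/- Let (F_1,…,F_m;k) be an instance of the hMaf problem satisfying the label-set isomorphism property, with {a,b} a minimum maximal sibling-set lying in F_1, such that |E_{F_i}(a,b)| ≤ 1 for all 2 ≤ i ≤ m, and suppose there exist two X-forests F_p, F_q with |E_{F_p}(a,b)| = |E_{F_q}(a,b)| = 1 and L(lca_{F_p}(a,b)) ≠ L(lca_{F_q}(a,b)) (Case 2.2.2). Then Branching Rule 2.2.2 — branch into three ways: [1] remove the edge incident to a in all X-forests; [2] remove the edge incident to b in all X-forests; [3] remove the edge of E_{F_i}(a,b) in every F_i for 2 ≤ i ≤ m and then apply the m-BR-process — is safe, and it satisfies the recurrence relation T(k) ≤ 2T(k−1) + T(k−2). -/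
/-!
A formalization framework for the Maximum Agreement Forest problem on multiple
rooted multifurcating phylogenetic trees.

An `X`-forest is modeled (up to forced contraction and label-preserving
isomorphism) by the laminar family of the label-sets `L(v)` of its vertices:
every vertex `v` is identified with the set `L(v)` of labels at its leaf
descendants, components correspond to the maximal clusters, leaves to the
singleton clusters, and the edge between a non-root vertex `v` and its parent
is identified with the cluster `L(v)`.
-/

open Finset

noncomputable section AuxProof
open scoped Classical
set_option linter.unusedSectionVars false
namespace MafAux
open XForest

variable {X : Type*} [DecidableEq X] [Fintype X] {m : ℕ}

/-- The part of `s` remaining after the edges in `D` below `s` are removed. -/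
def rest (D : Finset (Finset X)) (s : Finset X) : Finset X :=
  s \ (D.filter fun d => d ⊂ s).biUnion id

lemma mem_rest {D : Finset (Finset X)} {s : Finset X} {x : X} :
    x ∈ rest D s ↔ x ∈ s ∧ ∀ d ∈ D, d ⊂ s → x ∉ d := by
  unfold rest
  simp only [Finset.mem_sdiff, Finset.mem_biUnion, Finset.mem_filter, id]
  constructor
  · rintro ⟨h, h'⟩
    exact ⟨h, fun d hd hs hx => h' ⟨d, ⟨hd, hs⟩, hx⟩⟩
  · rintro ⟨h, h'⟩
    exact ⟨h, fun ⟨d, ⟨hd, hs⟩, hx⟩ => h' d hd hs hx⟩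

lemma mem_cut {F : XForest X} {D : Finset (Finset X)} (hD : D ⊆ F.clusters) {t : Finset X} :
    t ∈ (F.cut D).clusters ↔ t.Nonempty ∧ ∃ s ∈ F.clusters, rest D s = t := by
  have h : (D.filter fun d => d ∈ F.clusters) = D := by
    apply Finset.filter_true_of_mem
    exact hD
  unfold XForest.cut cutFam
  simp only
  rw [Finset.mem_filter, Finset.mem_image]
  rw [h]
  exact and_comm

lemma rest_sub {D : Finset (Finset X)} {s : Finset X} : rest D s ⊆ s :=
  fun _ h => (mem_rest.1 h).1

lemma lam {F : XForest X} {s t : Finset X} (hs : s ∈ F.clusters) (ht : t ∈ F.clusters) {x : X}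
    (h : x ∈ s) (h' : x ∈ t) : s ⊆ t ∨ t ⊂ s := by
  rcases F.laminar s hs t ht (Finset.not_disjoint_iff.2 ⟨x, h, h'⟩) with h1 | h1
  · exact Or.inl h1
  · by_cases e : t = s
    · exact Or.inl e.ge
    · exact Or.inr (Finset.ssubset_iff_subset_ne.2 ⟨h1, e⟩)

lemma rest_mono {F : XForest X} {D : Finset (Finset X)} (hD : D ⊆ F.clusters) {u w : Finset X}
    (hu : u ∈ F.clusters) (huw : u ⊆ w) {z : X} (hz : z ∈ u) (hzw : z ∈ rest D w) :
    rest D u ⊆ rest D w := by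
  intro y hy
  rw [mem_rest] at hy hzw ⊢
  refine ⟨huw hy.1, fun d hd hdw hyd => ?_⟩
  rcases lam hu (hD hd) hy.1 hyd with h | h
  · exact hzw.2 d hd hdw (h hz)
  · exact hy.2 d hd h hyd

/-- Iterated cuts. -/
lemma cut_cut (F : XForest X) {E D : Finset (Finset X)} (hE : E ⊆ F.clusters)
    (hD : D ⊆ F.clusters) {D' : Finset (Finset X)} (hD' : D' ⊆ (F.cut E).clusters)
    (h1 : ∀ d' ∈ D', ∃ d ∈ D, rest E d = d')
    (h2 : ∀ d ∈ D, (rest E d).Nonempty → rest E d ∈ D') :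
    ((F.cut E).cut D').clusters = (F.cut (E ∪ D)).clusters := by
  have hU : E ∪ D ⊆ F.clusters := Finset.union_subset hE hD
  -- membership in the two-step remainder
  have hR : ∀ t ∈ F.clusters, ∀ x, x ∈ rest (E ∪ D) t ↔
      x ∈ rest E t ∧ ∀ d ∈ D, d ⊂ t → x ∉ rest E d := by
    intro t ht x
    rw [mem_rest, mem_rest]
    constructor
    · rintro ⟨hx, h⟩
      exact ⟨⟨hx, fun d hd => h d (Finset.mem_union_left _ hd)⟩,
        fun d hd hdt hxd => h d (Finset.mem_union_right _ hd) hdt (rest_sub hxd)⟩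
    · rintro ⟨⟨hx, h⟩, h'⟩
      refine ⟨hx, fun d hd hdt hxd => ?_⟩
      rcases Finset.mem_union.1 hd with hd | hd
      · exact h d hd hdt hxd
      · refine h' d hd hdt (mem_rest.2 ⟨hxd, fun e he hed => h e he (hed.trans hdt)⟩)
  -- generic case
  have hgood : ∀ t ∈ F.clusters, (¬ ∃ d ∈ D, d ⊂ t ∧ rest E d = rest E t) →
      rest D' (rest E t) = rest (E ∪ D) t := by
    intro t ht hno
    ext x
    rw [hR t ht, mem_rest]
    constructor
    · rintro ⟨hx, h⟩
      refine ⟨hx, fun d hd hdt hxd => ?_⟩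
      refine h _ (h2 d hd ⟨x, hxd⟩) ?_ hxd
      refine Finset.ssubset_iff_subset_ne.2 ⟨?_, fun e => hno ⟨d, hd, hdt, e⟩⟩
      exact rest_mono hE (hD hd) hdt.subset (rest_sub hxd) hx
    · rintro ⟨hx, h⟩
      refine ⟨hx, fun d' hd' hdt hxd => ?_⟩
      obtain ⟨d, hd, rfl⟩ := h1 d' hd'
      rcases lam ht (hD hd) (rest_sub hx) (rest_sub hxd) with hh | hh
      · exact hdt.2 (rest_mono hE ht hh (rest_sub hx) hxd)
      · exact h d hd hh hxd
  have hbad : ∀ t ∈ F.clusters, (rest E t).Nonempty → ∃ t0 ∈ F.clusters,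
      rest E t0 = rest E t ∧ ¬ ∃ d ∈ D, d ⊂ t0 ∧ rest E d = rest E t0 := by
    intro t ht _
    obtain ⟨t0, ht0, hmin⟩ := Finset.exists_min_image
      (F.clusters.filter fun s => rest E s = rest E t) Finset.card
      ⟨t, Finset.mem_filter.2 ⟨ht, rfl⟩⟩
    rw [Finset.mem_filter] at ht0
    refine ⟨t0, ht0.1, ht0.2, ?_⟩
    rintro ⟨d, hd, hdt, he⟩
    have := hmin d (Finset.mem_filter.2 ⟨hD hd, he.trans ht0.2⟩)
    exact absurd (Finset.card_lt_card hdt) (not_lt.2 this)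
  ext u
  rw [mem_cut hD', mem_cut hU]
  constructor
  · rintro ⟨hu, s, hs, rfl⟩
    refine ⟨hu, ?_⟩
    obtain ⟨hsn, t, ht, rfl⟩ := (mem_cut hE).1 hs
    obtain ⟨t0, ht0, he, hno⟩ := hbad t ht hsn
    exact ⟨t0, ht0, by rw [← hgood t0 ht0 hno, he]⟩
  · rintro ⟨hu, t, ht, rfl⟩
    refine ⟨hu, ?_⟩
    obtain ⟨x, hx⟩ := hu
    have hx' := (hR t ht x).1 hx
    refine ⟨rest E t, (mem_cut hE).2 ⟨⟨x, hx'.1⟩, t, ht, rfl⟩, hgood t ht ?_⟩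
    rintro ⟨d, hd, hdt, he⟩
    exact hx'.2 d hd hdt (he ▸ hx'.1)

lemma sub_of_cut {G F : XForest X} {E : Finset (Finset X)} (hE : E ⊆ F.clusters)
    (h : IsSubforest G (F.cut E)) : IsSubforest G F := by
  obtain ⟨D', hD', hG⟩ := h
  refine ⟨E ∪ F.clusters.filter (fun t => rest E t ∈ D'),
    Finset.union_subset hE (Finset.filter_subset _ _), ?_⟩
  rw [hG]
  refine cut_cut F hE (Finset.filter_subset _ _) hD' ?_ ?_
  · intro d' hd'
    obtain ⟨-, s, hs, he⟩ := (mem_cut hE).1 (hD' hd')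
    exact ⟨s, Finset.mem_filter.2 ⟨hs, he ▸ hd'⟩, he⟩
  · intro d hd _
    exact (Finset.mem_filter.1 hd).2

/-- No component of `G` crosses the edge above `v`. -/
def NoCross (G : XForest X) (v : Finset X) : Prop :=
  ∀ s ∈ G.clusters, ∀ x ∈ s, x ∈ v → s ⊆ v

lemma cut_of_sub {G F : XForest X} {v : Finset X} (hv : v ∈ F.clusters)
    (hn : NoCross G v) (h : IsSubforest G F) : IsSubforest G (F.cut {v}) := by
  obtain ⟨D, hD, hG⟩ := h
  have hv' : {v} ⊆ F.clusters := by simpa using hv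
  have key : G.clusters = (F.cut ({v} ∪ D)).clusters := by
    by_cases hvD : v ∈ D
    · rw [hG]
      congr 2
      ext d
      simp only [Finset.mem_union, Finset.mem_singleton]
      constructor
      · exact Or.inr
      · rintro (rfl | h)
        · exact hvD
        · exact h
    have hU : {v} ∪ D ⊆ F.clusters := Finset.union_subset hv' hD
    have hmem : ∀ t x, x ∈ rest ({v} ∪ D) t ↔ x ∈ rest D t ∧ (v ⊂ t → x ∉ v) := by
      intro t x
      simp only [mem_rest, Finset.mem_union, Finset.mem_singleton]
      constructor
      · rintro ⟨h, h'⟩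
        exact ⟨⟨h, fun d hd => h' d (Or.inr hd)⟩, h' v (Or.inl rfl)⟩
      · rintro ⟨⟨h, h'⟩, h''⟩
        refine ⟨h, ?_⟩
        rintro d (rfl | hd)
        · exact h''
        · exact h' d hd
    have hGm : ∀ t ∈ F.clusters, (rest D t).Nonempty → rest D t ∈ G.clusters := by
      intro t ht hne
      rw [hG]
      exact (mem_cut hD).2 ⟨hne, t, ht, rfl⟩
    rw [hG]
    ext u
    rw [mem_cut hD, mem_cut hU]
    constructor
    · rintro ⟨hu, t, ht, rfl⟩
      refine ⟨hu, ?_⟩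
      by_cases hc : v ⊂ t ∧ ∃ x ∈ rest D t, x ∈ v
      · obtain ⟨hvt, x, hx, hxv⟩ := hc
        have hsub := hn _ (hGm t ht hu) x hx hxv
        refine ⟨v, hv, ?_⟩
        ext y
        rw [hmem]
        constructor
        · rintro ⟨hy, -⟩
          exact rest_mono hD hv hvt.subset hxv hx hy
        · intro hy
          refine ⟨mem_rest.2 ⟨hsub hy, fun d hd hdv => ?_⟩, fun h => absurd h (ssubset_irrefl _)⟩
          exact (mem_rest.1 hy).2 d hd (hdv.trans hvt)
      · refine ⟨t, ht, ?_⟩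
        ext y
        rw [hmem]
        constructor
        · exact fun h => h.1
        · exact fun hy => ⟨hy, fun hvt hyv => hc ⟨hvt, y, hy, hyv⟩⟩
    · rintro ⟨hu, t, ht, rfl⟩
      refine ⟨hu, t, ht, ?_⟩
      obtain ⟨x, hx⟩ := hu
      have hx' := (hmem _ _).1 hx
      ext y
      rw [hmem]
      refine ⟨fun hy => ⟨hy, fun hvt hyv => ?_⟩, fun h => h.1⟩
      exact hx'.2 hvt (hn _ (hGm t ht ⟨x, hx'.1⟩) y hy hyv hx'.1)
  refine ⟨(D.image (rest {v})).filter (fun s => s.Nonempty), ?_, ?_⟩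
  · intro d' hd'
    obtain ⟨hdi, hne⟩ := Finset.mem_filter.1 hd'
    obtain ⟨d, hd, rfl⟩ := Finset.mem_image.1 hdi
    exact (mem_cut hv').2 ⟨hne, d, hD hd, rfl⟩
  · rw [key]
    refine (cut_cut F hv' hD ?_ ?_ ?_).symm
    · intro d' hd'
      obtain ⟨hdi, hne⟩ := Finset.mem_filter.1 hd'
      obtain ⟨d, hd, rfl⟩ := Finset.mem_image.1 hdi
      exact (mem_cut hv').2 ⟨hne, d, hD hd, rfl⟩
    · intro d' hd'
      obtain ⟨hdi, hne⟩ := Finset.mem_filter.1 hd'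
      obtain ⟨d, hd, rfl⟩ := Finset.mem_image.1 hdi
      exact ⟨d, hd, rfl⟩
    · intro d hd hne
      exact Finset.mem_filter.2 ⟨Finset.mem_image.2 ⟨d, hd, rfl⟩, hne⟩

lemma sub_cut_iff {G F : XForest X} {v : Finset X} (hv : v ∈ F.clusters)
    (hn : IsSubforest G F → NoCross G v) : IsSubforest G F ↔ IsSubforest G (F.cut {v}) :=
  ⟨fun h => cut_of_sub hv (hn h) h, fun h => sub_of_cut (by simpa using hv) h⟩

/-! ### Components -/

/-- Two labels lie in the same component. -/
def Same (F : XForest X) (x y : X) : Prop := ∃ s ∈ F.clusters, x ∈ s ∧ y ∈ s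

lemma Same.refl (F : XForest X) (x : X) : Same F x x :=
  ⟨{x}, F.singleton_mem x, by simp, by simp⟩

lemma Same.symm {F : XForest X} {x y : X} (h : Same F x y) : Same F y x := by
  obtain ⟨s, hs, h1, h2⟩ := h
  exact ⟨s, hs, h2, h1⟩

lemma Same.trans {F : XForest X} {x y z : X} (h : Same F x y) (h' : Same F y z) : Same F x z := by
  obtain ⟨s, hs, h1, h2⟩ := h
  obtain ⟨t, ht, h3, h4⟩ := h'
  rcases lam hs ht h2 h3 with hh | hh
  · exact ⟨t, ht, hh h1, h4⟩
  · exact ⟨s, hs, h1, hh.subset h4⟩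

/-- The component containing `x`. -/
def cls (F : XForest X) (x : X) : Finset X := Finset.univ.filter (Same F x)

lemma mem_cls {F : XForest X} {x y : X} : y ∈ cls F x ↔ Same F x y := by simp [cls]

lemma cls_eq {F : XForest X} {x y : X} : cls F x = cls F y ↔ Same F x y := by
  constructor
  · intro h
    rw [← mem_cls, h, mem_cls]
    exact Same.refl F y
  · intro h
    ext z
    rw [mem_cls, mem_cls]
    exact ⟨h.symm.trans, h.trans⟩

lemma mem_comp {F : XForest X} {C : Finset X} : C ∈ F.components ↔
    C ∈ F.clusters ∧ ∀ t ∈ F.clusters, ¬ C ⊂ t := by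
  unfold XForest.components
  rw [Finset.mem_filter]

lemma comp_eq_cls {F : XForest X} {C : Finset X} (hC : C ∈ F.components) {x : X} (hx : x ∈ C) :
    C = cls F x := by
  rw [mem_comp] at hC
  ext y
  rw [mem_cls]
  constructor
  · exact fun hy => ⟨C, hC.1, hx, hy⟩
  · rintro ⟨s, hs, h1, h2⟩
    rcases lam hs hC.1 h1 hx with hh | hh
    · exact hh h2
    · exact absurd hh (hC.2 s hs)

lemma cls_comp (F : XForest X) (x : X) : cls F x ∈ F.components := by
  obtain ⟨t0, ht0, hmax⟩ := Finset.exists_max_image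
      (F.clusters.filter fun s => x ∈ s) Finset.card
      ⟨{x}, Finset.mem_filter.2 ⟨F.singleton_mem x, by simp⟩⟩
  rw [Finset.mem_filter] at ht0
  have : t0 ∈ F.components := by
    rw [mem_comp]
    refine ⟨ht0.1, fun t ht hlt => ?_⟩
    have := hmax t (Finset.mem_filter.2 ⟨ht, hlt.subset ht0.2⟩)
    exact absurd (Finset.card_lt_card hlt) (not_lt.2 this)
  rw [← comp_eq_cls this ht0.2]
  exact this

lemma comps_eq (F : XForest X) : F.components = Finset.univ.image (cls F) := by
  ext C
  rw [Finset.mem_image]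
  constructor
  · intro hC
    obtain ⟨x, hx⟩ := F.nonempty_of_mem C (mem_comp.1 hC).1
    exact ⟨x, Finset.mem_univ _, (comp_eq_cls hC hx).symm⟩
  · rintro ⟨x, -, rfl⟩
    exact cls_comp F x

lemma same_of_comp {F F' : XForest X} (h : F.components = F'.components) {x y : X} :
    Same F x y ↔ Same F' x y := by
  have : cls F x = cls F' x :=
    comp_eq_cls (h ▸ cls_comp F x) (mem_cls.2 (Same.refl F x))
  rw [← mem_cls, this, mem_cls]

lemma comp_of_same {F F' : XForest X} (h : ∀ x y, Same F x y ↔ Same F' x y) :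
    F.components = F'.components := by
  rw [comps_eq, comps_eq]
  congr 1
  funext x
  ext y
  rw [mem_cls, mem_cls, h]

lemma same_cut {F : XForest X} {v : Finset X} (hv : v ∈ F.clusters) {x y : X} :
    Same (F.cut {v}) x y ↔ Same F x y ∧ (x ∈ v ↔ y ∈ v) := by
  have hv' : {v} ⊆ F.clusters := by simpa using hv
  have hm : ∀ t z, z ∈ rest {v} t ↔ z ∈ t ∧ (v ⊂ t → z ∉ v) := by
    intro t z
    rw [mem_rest]
    simp
  constructor
  · rintro ⟨s, hs, h1, h2⟩
    obtain ⟨-, t, ht, rfl⟩ := (mem_cut hv').1 hs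
    rw [hm] at h1 h2
    refine ⟨⟨t, ht, h1.1, h2.1⟩, ?_⟩
    constructor
    · intro hx
      rcases lam ht hv h1.1 hx with hh | hh
      · exact hh h2.1
      · exact absurd hx (h1.2 hh)
    · intro hx
      rcases lam ht hv h2.1 hx with hh | hh
      · exact hh h1.1
      · exact absurd hx (h2.2 hh)
  · rintro ⟨⟨t, ht, h1, h2⟩, h⟩
    by_cases hx : x ∈ v
    · have e1 : x ∈ rest {v} v := (hm _ _).2 ⟨hx, fun h => absurd h (ssubset_irrefl _)⟩
      have e2 : y ∈ rest {v} v := (hm _ _).2 ⟨h.1 hx, fun h => absurd h (ssubset_irrefl _)⟩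
      exact ⟨rest {v} v, (mem_cut hv').2 ⟨⟨x, e1⟩, v, hv, rfl⟩, e1, e2⟩
    · have e1 : x ∈ rest {v} t := (hm _ _).2 ⟨h1, fun _ => hx⟩
      have e2 : y ∈ rest {v} t := (hm _ _).2 ⟨h2, fun _ hy => hx (h.2 hy)⟩
      exact ⟨rest {v} t, (mem_cut hv').2 ⟨⟨x, e1⟩, t, ht, rfl⟩, e1, e2⟩

lemma ord_cut {F : XForest X} {v t : Finset X} (hv : v ∈ F.clusters) (ht : t ∈ F.clusters)
    (hvt : v ⊂ t) : (F.cut {v}).ord = F.ord + 1 := by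
  obtain ⟨x0, hx0⟩ := F.nonempty_of_mem v hv
  obtain ⟨y0, hy0, hy0v⟩ := Finset.exists_of_ssubset hvt
  set K := cls F x0 with hK
  have hxy : Same F x0 y0 := ⟨t, ht, hvt.subset hx0, hy0⟩
  have hvK : v ⊆ K := fun z hz => mem_cls.2 ⟨v, hv, hx0, hz⟩
  have hcomp : (F.cut {v}).components = insert v (insert (K \ v) (F.components.erase K)) := by
    rw [comps_eq]
    have e1 : ∀ x ∈ v, cls (F.cut {v}) x = v := by
      intro x hx
      ext y
      rw [mem_cls, same_cut hv]
      exact ⟨fun h => h.2.1 hx, fun hy => ⟨⟨v, hv, hx, hy⟩, by tauto⟩⟩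
    have e2 : ∀ x ∈ K, x ∉ v → cls (F.cut {v}) x = K \ v := by
      intro x hx hxv
      have hxK : Same F x0 x := mem_cls.1 hx
      ext y
      rw [mem_cls, same_cut hv, Finset.mem_sdiff, mem_cls]
      constructor
      · exact fun h => ⟨hxK.trans h.1, fun hy => hxv (h.2.2 hy)⟩
      · exact fun h => ⟨hxK.symm.trans h.1, by tauto⟩
    have e3 : ∀ x, x ∉ K → cls (F.cut {v}) x = cls F x := by
      intro x hx
      ext y
      rw [mem_cls, same_cut hv, mem_cls]
      constructor
      · exact fun h => h.1
      · refine fun h => ⟨h, ?_⟩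
        have h1 : x ∉ v := fun h' => hx (hvK h')
        have h2 : y ∉ v := fun h' => hx (mem_cls.2 ((mem_cls.1 (hvK h')).trans h.symm))
        tauto
    ext C
    simp only [Finset.mem_image, Finset.mem_univ, true_and, Finset.mem_insert, Finset.mem_erase]
    constructor
    · rintro ⟨x, rfl⟩
      by_cases hx : x ∈ K
      · by_cases hxv : x ∈ v
        · exact Or.inl (e1 x hxv)
        · exact Or.inr (Or.inl (e2 x hx hxv))
      · rw [e3 x hx]
        refine Or.inr (Or.inr ⟨fun h => hx ?_, cls_comp F x⟩)
        rw [← h, mem_cls]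
        exact Same.refl F x
    · rintro (rfl | rfl | ⟨h1, h2⟩)
      · exact ⟨x0, e1 x0 hx0⟩
      · exact ⟨y0, e2 y0 (mem_cls.2 hxy) hy0v⟩
      · obtain ⟨x, hx⟩ := F.nonempty_of_mem C (mem_comp.1 h2).1
        have hCx := comp_eq_cls h2 hx
        refine ⟨x, ?_⟩
        rw [hCx]
        refine e3 x fun hxK => h1 ?_
        rw [hCx, hK, cls_eq]
        exact (mem_cls.1 hxK).symm
  unfold XForest.ord
  rw [hcomp, Finset.card_insert_of_notMem, Finset.card_insert_of_notMem, Finset.card_erase_of_mem]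
  · have : 0 < F.components.card := Finset.card_pos.2 ⟨K, cls_comp F x0⟩
    omega
  · exact cls_comp F x0
  · intro h
    obtain ⟨h1, h2⟩ := Finset.mem_erase.1 h
    have := comp_eq_cls h2 (Finset.mem_sdiff.2 ⟨mem_cls.2 hxy, hy0v⟩)
    exact h1 (by rw [this, hK, cls_eq]; exact hxy.symm)
  · intro h
    rcases Finset.mem_insert.1 h with h | h
    · exact (Finset.mem_sdiff.1 (h ▸ hx0)).2 hx0
    · exact (mem_comp.1 (Finset.mem_erase.1 h).2).2 t ht hvt

/-! ### Counting -/

lemma card_img_le {α β : Type*} [DecidableEq α] [DecidableEq β] {f : X → α} {g : X → β}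
    (h : ∀ x y, f x = f y → g x = g y) :
    (Finset.univ.image g).card ≤ (Finset.univ.image f).card ∧
    ((Finset.univ.image g).card = (Finset.univ.image f).card → ∀ x y, g x = g y → f x = f y) := by
  by_cases hX : Nonempty X
  · obtain ⟨x0⟩ := hX
    obtain ⟨r, hr⟩ : ∃ r : α → β, ∀ x, r (f x) = g x := by
      refine ⟨fun z => if hz : ∃ x, f x = z then g hz.choose else g x0, fun x => ?_⟩
      have hz : ∃ y, f y = f x := ⟨x, rfl⟩
      simp only [hz, dite_true]
      exact h _ _ hz.choose_spec
    have e : Finset.univ.image g = (Finset.univ.image f).image r := by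
      rw [Finset.image_image]
      congr 1
      funext x
      exact (hr x).symm
    refine ⟨by rw [e]; exact Finset.card_image_le, fun hc x y hxy => ?_⟩
    rw [e, Finset.card_image_iff] at hc
    exact hc (by simp) (by simp) (by rw [hr, hr, hxy])
  · refine ⟨?_, fun _ x => absurd ⟨x⟩ hX⟩
    have : (Finset.univ : Finset X) = ∅ := by
      rw [Finset.univ_eq_empty_iff]
      exact not_nonempty_iff.1 hX
    rw [this]
    simp

/-- The number of classes of the common refinement of the two component partitions. -/
def meetCard (F F' : XForest X) : ℕ := (Finset.univ.image fun x => (cls F x, cls F' x)).card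

lemma ord_eq (F : XForest X) : F.ord = (Finset.univ.image (cls F)).card := by
  unfold XForest.ord
  rw [comps_eq]

lemma pair_eq {F F' : XForest X} {x y : X} :
    ((cls F x, cls F' x) = (cls F y, cls F' y)) ↔ Same F x y ∧ Same F' x y := by
  rw [Prod.mk.injEq, cls_eq, cls_eq]

lemma ord_le_meet_left (F F' : XForest X) : F.ord ≤ meetCard F F' := by
  rw [ord_eq]
  exact (card_img_le fun x y h => cls_eq.2 (pair_eq.1 h).1).1

lemma ord_le_meet_right (F F' : XForest X) : F'.ord ≤ meetCard F F' := by
  rw [ord_eq]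
  exact (card_img_le fun x y h => cls_eq.2 (pair_eq.1 h).2).1

lemma meet_strict {F F' : XForest X} {n : ℕ} (h1 : n ≤ F.ord) (h2 : n ≤ F'.ord)
    (hne : ¬ F.components = F'.components) : n + 1 ≤ meetCard F F' := by
  by_contra hc
  have hl := ord_le_meet_left F F'
  have hr := ord_le_meet_right F F'
  have el : F.ord = meetCard F F' := by omega
  have er : F'.ord = meetCard F F' := by omega
  rw [ord_eq] at el er
  have k1 := (card_img_le (f := fun x => (cls F x, cls F' x)) (g := cls F)
    fun x y h => cls_eq.2 (pair_eq.1 h).1).2 el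
  have k2 := (card_img_le (f := fun x => (cls F x, cls F' x)) (g := cls F')
    fun x y h => cls_eq.2 (pair_eq.1 h).2).2 er
  refine hne (comp_of_same fun x y => ⟨fun h => ?_, fun h => ?_⟩)
  · exact (pair_eq.1 (k1 x y (cls_eq.2 h))).2
  · exact (pair_eq.1 (k2 x y (cls_eq.2 h))).1

lemma meet_of_iso {F F' : XForest X} (h : F.components = F'.components) :
    meetCard F F' = F.ord := by
  refine le_antisymm ?_ (ord_le_meet_left F F')
  rw [ord_eq]
  refine (card_img_le fun x y h' => ?_).1
  have := cls_eq.1 h'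
  exact pair_eq.2 ⟨this, (same_of_comp h).1 this⟩

lemma meet_mono {F F' H H' : XForest X} (h : ∀ x y, Same H x y → Same F x y)
    (h' : ∀ x y, Same H' x y → Same F' x y) :
    meetCard F F' ≤ meetCard H H' ∧
    (meetCard F F' = meetCard H H' → ∀ x y, Same F x y → Same F' x y →
      Same H x y ∧ Same H' x y) := by
  have := card_img_le (f := fun x => (cls H x, cls H' x)) (g := fun x => (cls F x, cls F' x))
    fun x y e => pair_eq.2 ⟨h _ _ (pair_eq.1 e).1, h' _ _ (pair_eq.1 e).2⟩
  exact ⟨this.1, fun e x y h1 h2 => pair_eq.1 (this.2 e x y (pair_eq.2 ⟨h1, h2⟩))⟩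

lemma meet_comm (F F' : XForest X) : meetCard F F' = meetCard F' F := by
  apply le_antisymm
  · exact (card_img_le (f := fun x => (cls F' x, cls F x)) fun x y e =>
      pair_eq.2 (pair_eq.1 e).symm).1
  · exact (card_img_le (f := fun x => (cls F x, cls F' x)) fun x y e =>
      pair_eq.2 (pair_eq.1 e).symm).1

/-! ### Safety of the basic rules -/

lemma same_of_sub {G F : XForest X} (h : IsSubforest G F) {x y : X} (hs : Same G x y) :
    Same F x y := by
  obtain ⟨D, hD, hG⟩ := h
  obtain ⟨s, hs, h1, h2⟩ := hs
  rw [hG] at hs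
  obtain ⟨-, t, ht, rfl⟩ := (mem_cut hD).1 hs
  exact ⟨t, ht, rest_sub h1, rest_sub h2⟩

lemma mem_of_same {F : XForest X} {C : Finset X} (hC : C ∈ F.components) {x y : X} (hx : x ∈ C)
    (h : Same F x y) : y ∈ C := by
  rw [comp_eq_cls hC hx, mem_cls]
  exact h

lemma noCross_RR1 {G Fi Fj : XForest X} {v : Finset X} (h : RR1App Fi Fj v)
    (hi : IsSubforest G Fi) (hj : IsSubforest G Fj) : NoCross G v := by
  obtain ⟨𝒞, h𝒞, -, C, hC, -, -, -, hv⟩ := h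
  intro s hs x hx hxv y hy
  have hG : Same G x y := ⟨s, hs, hx, hy⟩
  rw [hv, Finset.mem_inter, Finset.mem_biUnion] at hxv ⊢
  obtain ⟨hxC, C1, hC1, hxC1⟩ := hxv
  exact ⟨mem_of_same hC hxC (same_of_sub hj hG), C1, hC1,
    mem_of_same (h𝒞 hC1) hxC1 (same_of_sub hi hG)⟩

lemma noCross_BR1 {G Fi Fj : XForest X} {v c₁ c₂ : Finset X} (h : BR1AppCore Fi Fj v c₁ c₂)
    (hi : IsSubforest G Fi) (hj : IsSubforest G Fj) : NoCross G c₁ ∨ NoCross G c₂ := by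
  obtain ⟨C, hC, ch1, ch2, hne, hc1, hc2⟩ := h
  obtain ⟨D, hD, hG⟩ := hj
  have key : ∀ c, Fj.IsChild c v → ¬ NoCross G c → ∃ x ∈ c, x ∈ rest D v := by
    intro c ch hn
    unfold NoCross at hn
    push Not at hn
    obtain ⟨s, hs, x, hx, hxc, hsub⟩ := hn
    obtain ⟨y, hy, hyc⟩ := Finset.not_subset.1 hsub
    rw [hG] at hs
    obtain ⟨-, t, ht, rfl⟩ := (mem_cut hD).1 hs
    refine ⟨x, hxc, mem_rest.2 ⟨ch.2.2.1.subset hxc, fun d hd hdv => ?_⟩⟩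
    have hct : c ⊂ t := by
      rcases lam ht ch.1 (rest_sub hx) hxc with hh | hh
      · exact absurd (hh (rest_sub hy)) hyc
      · exact hh
    have hvt : v ⊆ t := by
      rcases lam ch.2.1 ht (ch.2.2.1.subset hxc) (rest_sub hx) with hh | hh
      · exact hh
      · exact absurd hh (ch.2.2.2 t ht hct)
    exact (mem_rest.1 hx).2 d hd (lt_of_lt_of_le hdv hvt)
  by_contra hcon
  push Not at hcon
  obtain ⟨x, hxc, hx⟩ := key c₁ ch1 hcon.1
  obtain ⟨z, hzc, hz⟩ := key c₂ ch2 hcon.2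
  have hs : Same G x z := by
    refine ⟨rest D v, ?_, hx, hz⟩
    rw [hG]
    exact (mem_cut hD).2 ⟨⟨x, hx⟩, v, ch1.2.1, rfl⟩
  have := mem_of_same hC (hc1 hxc) (same_of_sub hi hs)
  have : z ∈ c₂ ∩ C := Finset.mem_inter.2 ⟨hzc, this⟩
  rw [hc2] at this
  exact absurd this (Finset.notMem_empty _)

/-! ### Instances -/

/-- The instance obtained by removing one edge of the `j`-th forest. -/
def cutInst (I : Inst X m) (j : Fin m) (v : Finset X) : Inst X m :=
  ⟨Function.update I.F j ((I.F j).cut {v}), cutk I j⟩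

/-- `v` is a non-root vertex of `F`. -/
def NonRoot (F : XForest X) (v : Finset X) : Prop :=
  v ∈ F.clusters ∧ ∃ t ∈ F.clusters, v ⊂ t

/-- the invariant bound on the order of a solution. -/
def bnd (I : Inst X m) : ℤ := (I.ordMax : ℤ) + I.k

lemma ord_le_max (I : Inst X m) (i : Fin m) : (I.F i).ord ≤ I.ordMax :=
  Finset.le_sup (f := fun i => (I.F i).ord) (Finset.mem_univ i)

lemma cutInst_F_ne (I : Inst X m) {i j : Fin m} (v : Finset X) (h : i ≠ j) :
    (cutInst I j v).F i = I.F i := by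
  unfold cutInst
  exact Function.update_of_ne h _ _

lemma cutInst_F_eq (I : Inst X m) (j : Fin m) (v : Finset X) :
    (cutInst I j v).F j = (I.F j).cut {v} := by
  unfold cutInst
  exact Function.update_self _ _ _

lemma bnd_cutInst {I : Inst X m} {j : Fin m} {v : Finset X} (hv : NonRoot (I.F j) v) :
    bnd (cutInst I j v) = bnd I := by
  obtain ⟨h1, t, ht, hvt⟩ := hv
  have ho := ord_cut h1 ht hvt
  have hk : (cutInst I j v).k = cutk I j := rfl
  unfold bnd
  rw [hk]
  unfold cutk
  have hj := ord_le_max (cutInst I j v) j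
  rw [cutInst_F_eq, ho] at hj
  have hle : ∀ i, i ≠ j → (I.F i).ord ≤ (cutInst I j v).ordMax := by
    intro i hi
    have := ord_le_max (cutInst I j v) i
    rwa [cutInst_F_ne I v hi] at this
  have hge : I.ordMax ≤ (cutInst I j v).ordMax := by
    refine Finset.sup_le fun i _ => ?_
    by_cases hi : i = j
    · subst hi; omega
    · exact hle i hi
  have hup : ∀ n, I.ordMax ≤ n → (I.F j).ord + 1 ≤ n → (cutInst I j v).ordMax ≤ n := by
    intro n h1 h2
    refine Finset.sup_le fun i _ => ?_
    by_cases hi : i = j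
    · subst hi
      rw [cutInst_F_eq, ho]
      exact h2
    · rw [cutInst_F_ne I v hi]
      exact (ord_le_max I i).trans h1
  have hjI := ord_le_max I j
  split_ifs with h
  · have := hup (I.ordMax + 1) (by omega) (by omega)
    have : (cutInst I j v).ordMax = I.ordMax + 1 := by omega
    rw [this]
    push_cast
    ring
  · have := hup I.ordMax le_rfl (by omega)
    have : (cutInst I j v).ordMax = I.ordMax := by omega
    rw [this]

lemma haf_cutInst {I : Inst X m} {j : Fin m} {v : Finset X} (hv : v ∈ (I.F j).clusters)
    {G : XForest X} (h : IsHAF (cutInst I j v).F G) : IsHAF I.F G := by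
  intro i
  have hi := h i
  by_cases e : i = j
  · subst e
    rw [cutInst_F_eq] at hi
    exact sub_of_cut (by simpa using hv) hi
  · rwa [cutInst_F_ne I v e] at hi

lemma haf_cutInst' {I : Inst X m} {j : Fin m} {v : Finset X} (hv : v ∈ (I.F j).clusters)
    {G : XForest X} (hn : NoCross G v) (h : IsHAF I.F G) : IsHAF (cutInst I j v).F G := by
  intro i
  by_cases e : i = j
  · subst e
    rw [cutInst_F_eq]
    exact cut_of_sub hv hn (h i)
  · rw [cutInst_F_ne I v e]
    exact h i

lemma same_cutInst {I : Inst X m} {j : Fin m} {v : Finset X} (hv : v ∈ (I.F j).clusters)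
    (i : Fin m) {x y : X} (h : Same ((cutInst I j v).F i) x y) : Same (I.F i) x y := by
  by_cases e : i = j
  · subst e
    rw [cutInst_F_eq] at h
    exact ((same_cut hv).1 h).1
  · rwa [cutInst_F_ne I v e] at h

lemma RR1App.nonRoot {Fi Fj : XForest X} {v : Finset X} (h : RR1App Fi Fj v) : NonRoot Fj v := by
  obtain ⟨𝒞, -, -, C, -, hv, -, ht, -⟩ := h
  exact ⟨hv, ht⟩

/-- Everything preserved by exhaustive reduction. -/
structure Pres (I J : Inst X m) : Prop where
  bnd_eq : bnd J = bnd I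
  haf : ∀ G, IsHAF J.F G ↔ IsHAF I.F G
  same : ∀ i x y, Same (J.F i) x y → Same (I.F i) x y

lemma pres_of_step {I J : Inst X m} (h : RR1Step I J) : Pres I J := by
  obtain ⟨i, j, hij, v, hv, rfl⟩ := h
  have hnr := RR1App.nonRoot hv
  refine ⟨bnd_cutInst hnr, fun G => ⟨haf_cutInst hnr.1, fun h => ?_⟩,
    fun l x y => same_cutInst hnr.1 l⟩
  exact haf_cutInst' hnr.1 (noCross_RR1 hv (h i) (h j)) h

lemma pres_of_exhaust {I J : Inst X m} (h : RR1Exhaust I J) : Pres I J := by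
  have h' := h.1
  clear h
  induction h' with
  | refl => exact ⟨rfl, fun _ => Iff.rfl, fun _ _ _ h => h⟩
  | tail _ hs ih =>
    have := pres_of_step hs
    exact ⟨this.bnd_eq.trans ih.bnd_eq, fun G => (this.haf G).trans (ih.haf G),
      fun i x y h => ih.same i x y (this.same i x y h)⟩

lemma Pres.meet {I J : Inst X m} (h : Pres I J) (s t : Fin m) :
    meetCard (I.F s) (I.F t) ≤ meetCard (J.F s) (J.F t) :=
  (meet_mono (h.same s) (h.same t)).1

lemma Pres.ord {I J : Inst X m} (h : Pres I J) (s : Fin m) :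
    (I.F s).ord ≤ (J.F s).ord := by
  have := h.meet s s
  rwa [meet_of_iso rfl, meet_of_iso rfl] at this

/-- Removing a non-root edge to which Reduction Rule 1 does not apply strictly refines the
common refinement. -/
lemma meet_cut {Fi Fj : XForest X} {c : Finset X} (hc : NonRoot Fj c) (hno : ¬ RR1App Fi Fj c) :
    meetCard Fi Fj + 1 ≤ meetCard Fi (Fj.cut {c}) := by
  have hm := meet_mono (F := Fi) (F' := Fj) (H := Fi) (H' := Fj.cut {c})
    (fun _ _ h => h) (fun _ _ h => ((same_cut hc.1).1 h).1)
  by_contra hcon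
  have heq : meetCard Fi Fj = meetCard Fi (Fj.cut {c}) := by omega
  have hm2 := hm.2 heq
  obtain ⟨x0, hx0⟩ := Fj.nonempty_of_mem c hc.1
  have hcK : c ⊆ cls Fj x0 := fun z hz => mem_cls.2 ⟨c, hc.1, hx0, hz⟩
  refine hno ⟨Fi.components.filter (fun C => ∃ x ∈ c, x ∈ C), Finset.filter_subset _ _, ?_,
    cls Fj x0, cls_comp Fj x0, hc.1, hcK, hc.2, ?_⟩
  · exact ⟨cls Fi x0, Finset.mem_filter.2 ⟨cls_comp Fi x0, x0, hx0, mem_cls.2 (Same.refl _ _)⟩⟩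
  · ext y
    rw [Finset.mem_inter, Finset.mem_biUnion]
    constructor
    · intro hy
      exact ⟨hcK hy, cls Fi y, Finset.mem_filter.2 ⟨cls_comp Fi y, y, hy,
        mem_cls.2 (Same.refl _ _)⟩, mem_cls.2 (Same.refl _ _)⟩
    · rintro ⟨hyK, C, hC, hyC⟩
      obtain ⟨hC, x, hxc, hxC⟩ := Finset.mem_filter.1 hC
      have h1 : Same Fi x y := by
        rw [← mem_cls, ← comp_eq_cls hC hxC]
        exact hyC
      have h2 : Same Fj x y := (mem_cls.1 (hcK hxc)).symm.trans (mem_cls.1 hyK)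
      exact ((same_cut hc.1).1 (hm2 x y h1 h2).2).2.1 hxc

lemma meet_branch {I K : Inst X m} {p q i j : Fin m} {c : Finset X}
    (hij : (i = p ∧ j = q) ∨ (i = q ∧ j = p)) (hne : i ≠ j) (hno : ¬ RR1Applicable I)
    (hc : NonRoot (I.F j) c) (hK : Pres (cutInst I j c) K) :
    meetCard (I.F p) (I.F q) + 1 ≤ meetCard (K.F p) (K.F q) := by
  have h1 := meet_cut (Fi := I.F i) hc (fun h => hno ⟨i, j, hne, c, h⟩)
  have h2 := hK.meet i j
  rw [cutInst_F_eq, cutInst_F_ne I c hne] at h2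
  rcases hij with ⟨rfl, rfl⟩ | ⟨rfl, rfl⟩
  · omega
  · rw [meet_comm (I.F j), meet_comm (K.F j)]
    omega

lemma child_nonRoot {F : XForest X} {c v : Finset X} (h : F.IsChild c v) : NonRoot F c :=
  ⟨h.1, v, h.2.1, h.2.2.1⟩

/-- The properties of the collection produced by the 2-BR-process. -/
structure TreeProp (p q : Fin m) (I : Inst X m) (L : List (Inst X m × ℕ)) : Prop where
  bnd_eq : ∀ x ∈ L, bnd x.1 = bnd I
  norr : ∀ x ∈ L, ¬ RR1Applicable x.1
  iso : ∀ x ∈ L, LabelIso (x.1.F p) (x.1.F q)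
  meet : ∀ x ∈ L, meetCard (I.F p) (I.F q) + x.2 ≤ meetCard (x.1.F p) (x.1.F q)
  haf : ∀ G, IsHAF I.F G ↔ ∃ x ∈ L, IsHAF x.1.F G
  kraft : (L.map fun x => ((1 : ℝ) / 2) ^ x.2).sum = 1

lemma kraft_shift (L : List (Inst X m × ℕ)) (n : ℕ) :
    ((L.map fun x => (x.1, x.2 + n)).map fun x => ((1 : ℝ) / 2) ^ x.2).sum =
      (1 / 2) ^ n * (L.map fun x => ((1 : ℝ) / 2) ^ x.2).sum := by
  induction L with
  | nil => simp
  | cons a l ih =>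
    simp only [List.map_cons, List.sum_cons] at ih ⊢
    rw [ih]
    ring

lemma tree_prop {p q : Fin m} {I : Inst X m} {L : List (Inst X m × ℕ)}
    (h : TwoBRTree p q I L) (hno : ¬ RR1Applicable I) : TreeProp p q I L := by
  induction h with
  | done I h =>
    refine ⟨?_, ?_, ?_, ?_, ?_, ?_⟩ <;> simp_all
  | @step I I₁ I₂ K₁ K₂ L₁ L₂ i j v c₁ c₂ hij hbr he₁ he₂ h₁ h₂ ih₁ ih₂ =>
    obtain ⟨hne, hcore, rfl, rfl⟩ := hbr
    have P₁ : Pres (cutInst I j c₁) K₁ := pres_of_exhaust he₁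
    have P₂ : Pres (cutInst I j c₂) K₂ := pres_of_exhaust he₂
    have T₁ := ih₁ he₁.2
    have T₂ := ih₂ he₂.2
    have hcore' := hcore
    obtain ⟨C, hC, ch1, ch2, -, -, -⟩ := hcore'
    have n1 := child_nonRoot ch1
    have n2 := child_nonRoot ch2
    have m1 := meet_branch hij hne hno n1 P₁
    have m2 := meet_branch hij hne hno n2 P₂
    have hmem : ∀ x ∈ (L₁ ++ L₂).map (fun x => (x.1, x.2 + 1)),
        ∃ y, (y ∈ L₁ ∨ y ∈ L₂) ∧ x = (y.1, y.2 + 1) := by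
      intro x hx
      obtain ⟨y, hy, rfl⟩ := List.mem_map.1 hx
      exact ⟨y, List.mem_append.1 hy, rfl⟩
    refine ⟨?_, ?_, ?_, ?_, ?_, ?_⟩
    · intro x hx
      obtain ⟨y, hy | hy, rfl⟩ := hmem x hx
      · exact (T₁.bnd_eq y hy).trans (P₁.bnd_eq.trans (bnd_cutInst n1))
      · exact (T₂.bnd_eq y hy).trans (P₂.bnd_eq.trans (bnd_cutInst n2))
    · intro x hx
      obtain ⟨y, hy | hy, rfl⟩ := hmem x hx
      · exact T₁.norr y hy
      · exact T₂.norr y hy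
    · intro x hx
      obtain ⟨y, hy | hy, rfl⟩ := hmem x hx
      · exact T₁.iso y hy
      · exact T₂.iso y hy
    · intro x hx
      obtain ⟨y, hy | hy, rfl⟩ := hmem x hx
      · have := T₁.meet y hy
        simp only
        omega
      · have := T₂.meet y hy
        simp only
        omega
    · intro G
      constructor
      · intro hG
        rcases noCross_BR1 hcore (hG i) (hG j) with hn | hn
        · obtain ⟨x, hx, hxG⟩ := (T₁.haf G).1 ((P₁.haf G).2 (haf_cutInst' n1.1 hn hG))
          exact ⟨(x.1, x.2 + 1), List.mem_map.2 ⟨x, List.mem_append.2 (Or.inl hx), rfl⟩, hxG⟩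
        · obtain ⟨x, hx, hxG⟩ := (T₂.haf G).1 ((P₂.haf G).2 (haf_cutInst' n2.1 hn hG))
          exact ⟨(x.1, x.2 + 1), List.mem_map.2 ⟨x, List.mem_append.2 (Or.inr hx), rfl⟩, hxG⟩
      · rintro ⟨x, hx, hxG⟩
        obtain ⟨y, hy | hy, rfl⟩ := hmem x hx
        · exact haf_cutInst n1.1 ((P₁.haf G).1 ((T₁.haf G).2 ⟨y, hy, hxG⟩))
        · exact haf_cutInst n2.1 ((P₂.haf G).1 ((T₂.haf G).2 ⟨y, hy, hxG⟩))
    · rw [kraft_shift, List.map_append, List.sum_append, T₁.kraft, T₂.kraft]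
      norm_num

/-- The properties of the collections arising in the m-BR-process. -/
structure CollProp (r : ℕ) (J : Inst X m) (L : List (Inst X m × ℕ)) : Prop where
  bnd_eq : ∀ x ∈ L, bnd x.1 = bnd J
  norr : ∀ x ∈ L, ¬ RR1Applicable x.1
  meet : ∀ x ∈ L, ∀ s t, FirstSecond x.1 s t → ¬ LabelIso (x.1.F s) (x.1.F t) →
    r + x.2 ≤ meetCard (x.1.F s) (x.1.F t)
  fin : ∀ x ∈ L, InstLabelIso x.1 → r + x.2 ≤ x.1.ordMax
  haf : ∀ G, IsHAF J.F G ↔ ∃ x ∈ L, IsHAF x.1.F G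
  kraft : (L.map fun x => ((1 : ℝ) / 2) ^ x.2).sum = 1

lemma coll_step {r : ℕ} {J : Inst X m} {L L' : List (Inst X m × ℕ)} (h : CollStep L L')
    (hL : CollProp r J L) : CollProp r J L' := by
  induction h with
  | @step I n A B L s t hst hni htree =>
    have hI : (I, n) ∈ A ++ (I, n) :: B :=
      List.mem_append_right _ List.mem_cons_self
    have T := tree_prop htree (show ¬ RR1Applicable I from hL.norr (I, n) hI)
    have hr := hL.meet (I, n) hI s t hst hni
    have hA : ∀ x, x ∈ A ∨ x ∈ B → x ∈ A ++ (I, n) :: B := by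
      rintro x (h | h)
      · exact List.mem_append_left _ h
      · exact List.mem_append_right _ (List.mem_cons_of_mem _ h)
    have hmem : ∀ x, x ∈ A ++ L.map (fun y => (y.1, y.2 + n)) ++ B ↔
        (x ∈ A ∨ x ∈ B) ∨ ∃ y ∈ L, (y.1, y.2 + n) = x := by
      intro x
      rw [List.mem_append, List.mem_append, List.mem_map, or_right_comm]
    have hord : ∀ y ∈ L, r + (y.2 + n) ≤ (y.1.F s).ord ∧ r + (y.2 + n) ≤ (y.1.F t).ord := by
      intro y hy
      have h1 := T.meet y hy
      have h2 := meet_of_iso (T.iso y hy)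
      have h3 : (y.1.F s).ord = (y.1.F t).ord := by
        unfold XForest.ord
        rw [show (y.1.F s).components = (y.1.F t).components from T.iso y hy]
      simp only at hr
      omega
    refine ⟨?_, ?_, ?_, ?_, ?_, ?_⟩
    · intro x hx
      rcases (hmem x).1 hx with hx | ⟨y, hy, rfl⟩
      · exact hL.bnd_eq x (hA x hx)
      · exact (T.bnd_eq y hy).trans (hL.bnd_eq (I, n) hI)
    · intro x hx
      rcases (hmem x).1 hx with hx | ⟨y, hy, rfl⟩
      · exact hL.norr x (hA x hx)
      · exact T.norr y hy
    · intro x hx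
      rcases (hmem x).1 hx with hx | ⟨y, hy, rfl⟩
      · exact hL.meet x (hA x hx)
      · intro s' t' hst' _
        simp only at hst' ⊢
        have ho := hord y hy
        have hr' := ord_le_meet_right (y.1.F s') (y.1.F t')
        by_cases e : s = s'
        · have := hst'.2.2 t (by rw [← e]; exact hst.1.symm)
          omega
        · have := hst'.2.2 s e
          omega
    · intro x hx
      rcases (hmem x).1 hx with hx | ⟨y, hy, rfl⟩
      · exact hL.fin x (hA x hx)
      · intro _
        exact (hord y hy).1.trans (ord_le_max y.1 s)
    · intro G
      rw [hL.haf G]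
      constructor
      · rintro ⟨x, hx, hxG⟩
        rcases List.mem_append.1 hx with hx | hx
        · exact ⟨x, (hmem x).2 (Or.inl (Or.inl hx)), hxG⟩
        rcases List.mem_cons.1 hx with rfl | hx
        · obtain ⟨y, hy, hyG⟩ := (T.haf G).1 hxG
          exact ⟨(y.1, y.2 + n), (hmem _).2 (Or.inr ⟨y, hy, rfl⟩), hyG⟩
        · exact ⟨x, (hmem x).2 (Or.inl (Or.inr hx)), hxG⟩
      · rintro ⟨x, hx, hxG⟩
        rcases (hmem x).1 hx with hx | ⟨y, hy, rfl⟩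
        · exact ⟨x, hA x hx, hxG⟩
        · exact ⟨(I, n), hI, (T.haf G).2 ⟨y, hy, hxG⟩⟩
    · have := hL.kraft
      simp only [List.map_append, List.sum_append, List.map_cons, List.sum_cons] at this ⊢
      rw [kraft_shift, T.kraft]
      linarith

lemma sum_T_le {T : ℤ → ℝ} (h0 : ∀ x, 0 ≤ T x) (hmono : Monotone T)
    (hT : ∀ x : ℤ, (2 : ℝ) * T (x - 1) + T (x - 2) ≤ T x) (k : ℤ) (L : List (Inst X m × ℕ))
    (hL : ∀ x ∈ L, x.1.k ≤ k - x.2) :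
    (L.map fun x => T x.1.k).sum ≤ (L.map fun x => ((1 : ℝ) / 2) ^ x.2).sum * T k := by
  have hpow : ∀ n : ℕ, T (k - n) ≤ (1 / 2) ^ n * T k := by
    intro n
    induction n with
    | zero => simp
    | succ n ih =>
      have h1 := hT (k - n)
      have h2 := h0 (k - n - 2)
      have e : k - ((n + 1 : ℕ) : ℤ) = k - n - 1 := by push_cast; ring
      rw [e, pow_succ]
      linarith
  induction L with
  | nil => simp
  | cons a l ih =>
    simp only [List.map_cons, List.sum_cons]
    have h1 := (hmono (hL a (by simp))).trans (hpow a.2)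
    have h2 := ih fun x hx => hL x (by simp [hx])
    linarith

/-! ### The least common ancestor and the set `E(a,b)` -/

lemma lca_spec {F : XForest X} {a b : X} (h : Same F a b) :
    F.lca2 a b ∈ F.clusters ∧ a ∈ F.lca2 a b ∧ b ∈ F.lca2 a b ∧
      ∀ s ∈ F.clusters, a ∈ s → b ∈ s → F.lca2 a b ⊆ s := by
  obtain ⟨s0, hs0, ha0, hb0⟩ := h
  obtain ⟨t, ht, hmin⟩ := Finset.exists_min_image
      (F.clusters.filter fun s => a ∈ s ∧ b ∈ s) Finset.card
      ⟨s0, Finset.mem_filter.2 ⟨hs0, ha0, hb0⟩⟩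
  have ht' := Finset.mem_filter.1 ht
  have hsub : ∀ s ∈ F.clusters, a ∈ s → b ∈ s → t ⊆ s := by
    intro s hs ha hb
    rcases lam ht'.1 hs ht'.2.1 ha with hh | hh
    · exact hh
    · have := hmin s (Finset.mem_filter.2 ⟨hs, ha, hb⟩)
      exact absurd (Finset.card_lt_card hh) (not_lt.2 this)
  have e : F.lca2 a b = t := by
    unfold XForest.lca2
    apply le_antisymm
    · exact Finset.inf_le (f := id) ht
    · refine Finset.le_inf fun s hs => ?_
      have hs' := Finset.mem_filter.1 hs
      exact hsub s hs'.1 hs'.2.1 hs'.2.2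
  rw [e]
  exact ⟨ht'.1, ht'.2.1, ht'.2.2, hsub⟩

lemma eset_spec {F : XForest X} {a b : X} (h : Same F a b) {d : Finset X} (hd : d ∈ F.Eset a b) :
    d ∈ F.clusters ∧ d ⊂ F.lca2 a b ∧ a ∉ d ∧ b ∉ d := by
  obtain ⟨hl, hal, hbl, hmin⟩ := lca_spec h
  unfold XForest.Eset at hd
  rcases Finset.mem_union.1 hd with hd | hd
  · obtain ⟨hdc, c, hc, hch, hcl, hcase⟩ := Finset.mem_filter.1 hd
    have hdc' := hch.2.2.1
    refine ⟨hdc, hdc'.trans hcl, ?_⟩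
    rcases hcase with ⟨hac, -, had⟩ | ⟨hbc, -, hbd⟩
    · exact ⟨had, fun hbd => hcl.2 (hmin c hc hac (hdc'.subset hbd))⟩
    · exact ⟨fun had => hcl.2 (hmin c hc (hdc'.subset had) hbc), hbd⟩
  · obtain ⟨hdc, hch, had, hbd⟩ := Finset.mem_filter.1 hd
    exact ⟨hdc, hch.2.2.1, had, hbd⟩

lemma eset_cover {F : XForest X} {a b : X} (h : Same F a b) {e : Finset X}
    (he : e ∈ F.clusters) (hel : e ⊆ F.lca2 a b) (hae : a ∉ e) (hbe : b ∉ e) :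
    ∃ d ∈ F.Eset a b, e ⊆ d := by
  obtain ⟨hl, hal, hbl, hmin⟩ := lca_spec h
  obtain ⟨d, hd, hmax⟩ := Finset.exists_max_image
      (F.clusters.filter fun s => e ⊆ s ∧ s ⊆ F.lca2 a b ∧ a ∉ s ∧ b ∉ s) Finset.card
      ⟨e, Finset.mem_filter.2 ⟨he, subset_rfl, hel, hae, hbe⟩⟩
  obtain ⟨hdc, hed, hdl, had, hbd⟩ := Finset.mem_filter.1 hd
  have hdl' : d ⊂ F.lca2 a b :=
    Finset.ssubset_iff_subset_ne.2 ⟨hdl, fun h => had (h ▸ hal)⟩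
  obtain ⟨c, hc, hcmin⟩ := Finset.exists_min_image
      (F.clusters.filter fun s => d ⊂ s) Finset.card
      ⟨F.lca2 a b, Finset.mem_filter.2 ⟨hl, hdl'⟩⟩
  obtain ⟨hcc, hdc'⟩ := Finset.mem_filter.1 hc
  have hch : F.IsChild d c := by
    refine ⟨hdc, hcc, hdc', fun t ht hdt htc => ?_⟩
    have := hcmin t (Finset.mem_filter.2 ⟨ht, hdt⟩)
    exact absurd (Finset.card_lt_card htc) (not_lt.2 this)
  obtain ⟨x, hx⟩ := F.nonempty_of_mem d hdc
  have hcl : c ⊆ F.lca2 a b := by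
    rcases lam hcc hl (hdc'.subset hx) (hdl hx) with hh | hh
    · exact hh
    · exact absurd hh (hch.2.2.2 _ hl hdl')
  refine ⟨d, ?_, hed⟩
  unfold XForest.Eset
  rw [Finset.mem_union]
  by_cases hceq : c = F.lca2 a b
  · right
    exact Finset.mem_filter.2 ⟨hdc, hceq ▸ hch, had, hbd⟩
  · left
    refine Finset.mem_filter.2 ⟨hdc, c, hcc, hch, Finset.ssubset_iff_subset_ne.2 ⟨hcl, hceq⟩, ?_⟩
    have hxd : x ∈ c := hdc'.subset hx
    by_cases hac : a ∈ c
    · left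
      refine ⟨hac, fun h => had ?_, had⟩
      rw [h, Finset.mem_singleton] at hxd
      exact hxd ▸ hx
    · right
      have hbc : b ∈ c := by
        by_contra hbc
        have := hmax c (Finset.mem_filter.2 ⟨hcc, hed.trans hdc'.subset, hcl, hac, hbc⟩)
        exact absurd (Finset.card_lt_card hdc') (not_lt.2 this)
      refine ⟨hbc, fun h => hbd ?_, hbd⟩
      rw [h, Finset.mem_singleton] at hxd
      exact hxd ▸ hx

lemma lca_eq {F : XForest X} {a b : X} (h : Same F a b) {d : Finset X}
    (hd : F.Eset a b = {d}) : F.lca2 a b = {a, b} ∪ d := by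
  obtain ⟨hl, hal, hbl, hmin⟩ := lca_spec h
  have hs := eset_spec h (d := d) (by rw [hd]; simp)
  ext x
  simp only [Finset.mem_union, Finset.mem_insert, Finset.mem_singleton]
  constructor
  · intro hx
    by_cases hxa : x = a
    · exact Or.inl (Or.inl hxa)
    by_cases hxb : x = b
    · exact Or.inl (Or.inr hxb)
    obtain ⟨e, he, hxe⟩ := eset_cover h (F.singleton_mem x) (by simpa using hx)
      (by simpa using Ne.symm hxa) (by simpa using Ne.symm hxb)
    rw [hd, Finset.mem_singleton] at he
    right
    rw [← he]
    exact hxe (by simp)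
  · rintro ((rfl | rfl) | hx)
    · exact hal
    · exact hbl
    · exact hs.2.1.subset hx

/-- If `{a,b}` is a cluster of the subforest `G` then the unique edge in `E(a,b)` is not used. -/
lemma noCross_eset {G F : XForest X} {a b : X} (hG : IsSubforest G F)
    (hab : ({a, b} : Finset X) ∈ G.clusters) {d : Finset X}
    (hd : F.Eset a b = {d}) : NoCross G d := by
  have hsame : Same F a b := same_of_sub hG ⟨_, hab, by simp, by simp⟩
  obtain ⟨hl, hal, hbl, hmin⟩ := lca_spec hsame
  obtain ⟨hdc, hdl, had, hbd⟩ := eset_spec hsame (d := d) (by rw [hd]; simp)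
  obtain ⟨D, hD, hGc⟩ := hG
  rw [hGc] at hab
  obtain ⟨-, t, ht, het⟩ := (mem_cut hD).1 hab
  have hat : a ∈ rest D t := by rw [het]; simp
  have hbt : b ∈ rest D t := by rw [het]; simp
  have hlt : F.lca2 a b ⊆ t := hmin t ht (rest_sub hat) (rest_sub hbt)
  -- every element of `d` is covered by a removed edge inside `d`
  have hcov : ∀ x ∈ d, ∃ e ∈ D, x ∈ e ∧ e ⊆ d := by
    intro x hx
    have hxt : x ∉ rest D t := by
      rw [het]
      simp only [Finset.mem_insert, Finset.mem_singleton]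
      rintro (rfl | rfl)
      · exact had hx
      · exact hbd hx
    have hx' : x ∈ t := hlt (hdl.subset hx)
    have : ∃ e ∈ D, e ⊂ t ∧ x ∈ e := by
      by_contra hcon
      push Not at hcon
      exact hxt (mem_rest.2 ⟨hx', hcon⟩)
    obtain ⟨e, he, het', hxe⟩ := this
    have hae := (mem_rest.1 hat).2 e he het'
    have hbe := (mem_rest.1 hbt).2 e he het'
    have hel : e ⊆ F.lca2 a b := by
      rcases lam (hD he) hl hxe (hdl.subset hx) with hh | hh
      · exact hh
      · exact absurd (hh.subset hal) hae
    obtain ⟨d', hd', hed⟩ := eset_cover hsame (hD he) hel hae hbe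
    rw [hd, Finset.mem_singleton] at hd'
    exact ⟨e, he, hxe, hd' ▸ hed⟩
  intro s hs x hx hxd
  rw [hGc] at hs
  obtain ⟨-, u, hu, rfl⟩ := (mem_cut hD).1 hs
  rcases lam hu hdc (rest_sub hx) hxd with hh | hh
  · exact rest_sub.trans hh
  · obtain ⟨e, he, hxe, hed⟩ := hcov x hxd
    exact absurd hxe ((mem_rest.1 hx).2 e he (lt_of_le_of_lt hed hh))

lemma mss_cluster {G F : XForest X} {a b : X} (hab : a ≠ b) (hM : F.IsMSS {a, b})
    (hG : IsSubforest G F) (ha : ¬ NoCross G {a}) (hb : ¬ NoCross G {b}) :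
    ({a, b} : Finset X) ∈ G.clusters := by
  obtain ⟨D, hD, hGc⟩ := hG
  have key : ∀ c, ¬ NoCross G {c} → ({c} : Finset X) ∉ D := by
    intro c hc hcD
    refine hc fun s hs x hx hxc => ?_
    rw [Finset.mem_singleton] at hxc
    subst hxc
    rw [hGc] at hs
    obtain ⟨-, u, hu, rfl⟩ := (mem_cut hD).1 hs
    rcases lam hu (F.singleton_mem x) (rest_sub hx) (by simp) with hh | hh
    · exact rest_sub.trans hh
    · exact absurd (by simp) ((mem_rest.1 hx).2 _ hcD hh)
  have e : rest D {a, b} = {a, b} := by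
    refine subset_antisymm rest_sub fun x hx => mem_rest.2 ⟨hx, fun d hd hds hxd => ?_⟩
    have h1 := hM.2.2 d (hD hd) hds
    obtain ⟨y, rfl⟩ := Finset.card_eq_one.1 h1
    rw [Finset.mem_singleton] at hxd
    subst hxd
    rcases Finset.mem_insert.1 hx with rfl | hx
    · exact key _ ha hd
    · rw [Finset.mem_singleton] at hx
      subst hx
      exact key _ hb hd
  rw [hGc]
  exact (mem_cut hD).2 ⟨by simp, _, hM.1, e⟩

lemma cut_empty (F : XForest X) : (F.cut ∅).clusters = F.clusters := by
  ext t
  rw [mem_cut (by simp)]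
  have : ∀ s : Finset X, rest ∅ s = s := fun s => by simp [rest]
  constructor
  · rintro ⟨-, s, hs, rfl⟩
    rwa [this]
  · exact fun h => ⟨F.nonempty_of_mem t h, t, h, this t⟩

lemma sub_cut_eset {G F : XForest X} {a b : X} (hc : (F.Eset a b).card ≤ 1)
    (hab : ({a, b} : Finset X) ∈ G.clusters) (hG : IsSubforest G F) :
    IsSubforest G (F.cut (F.Eset a b)) := by
  have hsame : Same F a b := same_of_sub hG ⟨_, hab, by simp, by simp⟩
  rcases Finset.card_le_one_iff_subset_singleton.1 hc with ⟨d, hd⟩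
  rcases Finset.subset_singleton_iff.1 hd with h | h
  · rw [h]
    obtain ⟨D, hD, hGc⟩ := hG
    refine ⟨D, by rwa [cut_empty], ?_⟩
    rw [hGc]
    unfold XForest.cut at *
    simp only at *
    rw [show cutFam F.clusters (Finset.filter (fun d => d ∈ F.clusters) ∅) = F.clusters from
      cut_empty F]
  · have hs := eset_spec hsame (d := d) (by rw [h]; simp)
    rw [h]
    exact cut_of_sub hs.1 (noCross_eset hG hab h) hG

lemma isYes_iff {I : Inst X m} : I.IsYes ↔ ∃ G, IsHAF I.F G ∧ (G.ord : ℤ) ≤ bnd I := Iff.rfl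

lemma bnd_leaf {I I₁ : Inst X m} (i0 : Fin m) {a b : X} (hab : a ≠ b)
    (hiso : InstLabelIso I) (hs : ∀ i, Same (I.F i) a b)
    (hF : I₁.F = fun i => (I.F i).cut {({a} : Finset X)}) (hk : I₁.k = I.k - 1) :
    bnd I₁ = bnd I := by
  have ho : ∀ i, (I₁.F i).ord = (I.F i0).ord + 1 := by
    intro i
    obtain ⟨t, ht, hat, hbt⟩ := hs i
    have hss : ({a} : Finset X) ⊂ t := by
      refine ⟨by simpa using hat, fun h => hab ?_⟩
      have := h hbt
      rw [Finset.mem_singleton] at this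
      exact this.symm
    have h1 := ord_cut ((I.F i).singleton_mem a) ht hss
    have h2 : (I.F i).ord = (I.F i0).ord := by
      unfold XForest.ord
      rw [show (I.F i).components = (I.F i0).components from hiso i i0]
    rw [hF, ← h2]
    exact h1
  have e1 : I₁.ordMax = (I.F i0).ord + 1 := by
    refine le_antisymm (Finset.sup_le fun i _ => (ho i).le) ?_
    rw [← ho i0]
    exact ord_le_max I₁ i0
  have e2 : I.ordMax = (I.F i0).ord := by
    refine le_antisymm (Finset.sup_le fun i _ => ?_) (ord_le_max I i0)
    unfold XForest.ord
    rw [show (I.F i).components = (I.F i0).components from hiso i i0]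
  unfold bnd
  rw [e1, e2, hk]
  push_cast
  ring

lemma eset_mss {F : XForest X} {a b : X} (hM : F.IsMSS {a, b}) : F.Eset a b = ∅ := by
  have hsame : Same F a b := ⟨_, hM.1, by simp, by simp⟩
  obtain ⟨hl, hal, hbl, hmin⟩ := lca_spec hsame
  have hsub := hmin _ hM.1 (by simp) (by simp)
  rw [Finset.eq_empty_iff_forall_notMem]
  intro d hd
  obtain ⟨hdc, hdl, had, hbd⟩ := eset_spec hsame hd
  obtain ⟨x, hx⟩ := F.nonempty_of_mem d hdc
  have := hsub (hdl.subset hx)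
  simp only [Finset.mem_insert, Finset.mem_singleton] at this
  rcases this with rfl | rfl
  · exact had hx
  · exact hbd hx

lemma coll_steps {r : ℕ} {J : Inst X m} {L L' : List (Inst X m × ℕ)}
    (h : Relation.ReflTransGen CollStep L L') (hL : CollProp r J L) : CollProp r J L' := by
  induction h with
  | refl => exact hL
  | tail _ hs ih => exact coll_step hs ih

end MafAux
end AuxProof

/-- Lemma 4.6, Branching Rule 2.2.2.  Let `(F_1, …, F_m; k)`
satisfy the label-set isomorphism property with `{a,b}` a minimum MSS lying in
`F_1`, suppose `|E_{F_i}(a,b)| ≤ 1` for `2 ≤ i ≤ m`, and there are `F_p, F_q`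
with `|E_{F_p}(a,b)| = |E_{F_q}(a,b)| = 1` and
`L(lca_{F_p}(a,b)) ≠ L(lca_{F_q}(a,b))` (Case 2.2.2).  Then Branching Rule
2.2.2 — [1] remove the edge incident to `a` in all forests; [2] remove the
edge incident to `b` in all forests; [3] remove the edge of `E_{F_i}(a,b)` in
every `F_i`, `2 ≤ i ≤ m`, followed by the m-BR-process — is safe, and it
satisfies the recurrence relation `T(k) ≤ 2·T(k-1) + T(k-2)`. -/
theorem statement_12 {X : Type*} [DecidableEq X] [Fintype X] {m : ℕ} (hm : 0 < m)
    (I I₁ I₂ I₃ : Inst X m) (a b : X) (hab : a ≠ b)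
    (hiso : InstLabelIso I)
    (hMSS : I.MinMSS ⟨0, hm⟩ {a, b})
    (hsmall : ∀ i : Fin m, i ≠ ⟨0, hm⟩ → ((I.F i).Eset a b).card ≤ 1)
    (p q : Fin m)
    (hp : ((I.F p).Eset a b).card = 1) (hq : ((I.F q).Eset a b).card = 1)
    (hlca : (I.F p).lca2 a b ≠ (I.F q).lca2 a b)
    (hI₁F : I₁.F = fun i => (I.F i).cut {({a} : Finset X)}) (hI₁k : I₁.k = I.k - 1)
    (hI₂F : I₂.F = fun i => (I.F i).cut {({b} : Finset X)}) (hI₂k : I₂.k = I.k - 1)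
    (hI₃F : I₃.F = fun i =>
      if i = ⟨0, hm⟩ then I.F i else (I.F i).cut ((I.F i).Eset a b))
    (hI₃k : I₃.k = I.k + I.ordMax - I₃.ordMax) :
    ∀ L : List (Inst X m × ℕ), MBRTree I₃ L →
      (I.IsYes ↔ I₁.IsYes ∨ I₂.IsYes ∨ ∃ x ∈ L, x.1.IsYes) ∧
      (∀ x ∈ L, x.1.k ≤ I.k - 2 - x.2) ∧
      RecBound I.k (I₁.k :: I₂.k :: L.map fun x => x.1.k) 2 1 := by
  classical
  open MafAux in
  intro L hL
  obtain ⟨J, hJ, hcoll, hLiso⟩ := hL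
  set i0 : Fin m := ⟨0, hm⟩ with hi0
  have hM := hMSS.1
  have hsame0 : Same (I.F i0) a b := ⟨_, hM.1, by simp, by simp⟩
  have hsame : ∀ i, Same (I.F i) a b := fun i => (same_of_comp (hiso i0 i)).1 hsame0
  have hE0 := eset_mss hM
  have hp0 : p ≠ i0 := by
    rintro rfl
    rw [hE0] at hp
    simp at hp
  have hq0 : q ≠ i0 := by
    rintro rfl
    rw [hE0] at hq
    simp at hq
  have b1 : bnd I₁ = bnd I := bnd_leaf i0 hab hiso hsame hI₁F hI₁k
  have b2 : bnd I₂ = bnd I :=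
    bnd_leaf i0 hab.symm hiso (fun i => (hsame i).symm) hI₂F hI₂k
  have b3 : bnd I₃ = bnd I := by
    unfold bnd
    rw [hI₃k]
    ring
  -- the orders
  have hordI : ∀ i, (I.F i).ord = I.ordMax := by
    intro i
    refine le_antisymm (ord_le_max I i) (Finset.sup_le fun j _ => ?_)
    unfold XForest.ord
    rw [show (I.F j).components = (I.F i).components from hiso j i]
  obtain ⟨dp, hdp⟩ := Finset.card_eq_one.1 hp
  obtain ⟨dq, hdq⟩ := Finset.card_eq_one.1 hq
  have sp := eset_spec (hsame p) (d := dp) (by rw [hdp]; simp)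
  have sq := eset_spec (hsame q) (d := dq) (by rw [hdq]; simp)
  have hFp : I₃.F p = (I.F p).cut {dp} := by
    rw [hI₃F]
    simp only [if_neg hp0, hdp]
  have hFq : I₃.F q = (I.F q).cut {dq} := by
    rw [hI₃F]
    simp only [if_neg hq0, hdq]
  have op : (I₃.F p).ord = I.ordMax + 1 := by
    rw [hFp, ord_cut sp.1 (lca_spec (hsame p)).1 sp.2.1, hordI]
  have oq : (I₃.F q).ord = I.ordMax + 1 := by
    rw [hFq, ord_cut sq.1 (lca_spec (hsame q)).1 sq.2.1, hordI]
  have hdne : dp ≠ dq := by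
    intro h
    apply hlca
    rw [lca_eq (hsame p) hdp, lca_eq (hsame q) hdq, h]
  have hcne : ¬ (I₃.F p).components = (I₃.F q).components := by
    intro h
    apply hdne
    rw [hFp, hFq] at h
    ext x
    constructor
    · intro hx
      by_contra hxq
      have h1 : Same (I.F q) x a := (same_of_comp (hiso p q)).1
        ⟨_, (lca_spec (hsame p)).1, sp.2.1.subset hx, (lca_spec (hsame p)).2.1⟩
      have h2 := (same_of_comp h).2 ((same_cut sq.1).2 ⟨h1, iff_of_false hxq sq.2.2.1⟩)
      exact sp.2.2.1 (((same_cut sp.1).1 h2).2.1 hx)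
    · intro hx
      by_contra hxp
      have h1 : Same (I.F p) x a := (same_of_comp (hiso q p)).1
        ⟨_, (lca_spec (hsame q)).1, sq.2.1.subset hx, (lca_spec (hsame q)).2.1⟩
      have h2 := (same_of_comp h).1 ((same_cut sp.1).2 ⟨h1, iff_of_false hxp sp.2.2.1⟩)
      exact sq.2.2.1 (((same_cut sq.1).1 h2).2.1 hx)
  have hmeet : I.ordMax + 1 + 1 ≤ meetCard (I₃.F p) (I₃.F q) :=
    meet_strict op.ge oq.ge hcne
  have P := pres_of_exhaust hJ
  have hinit : CollProp (I.ordMax + 2) J [(J, 0)] := by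
    refine ⟨?_, ?_, ?_, ?_, ?_, ?_⟩
    · intro x hx
      rw [List.mem_singleton] at hx
      rw [hx]
    · intro x hx
      rw [List.mem_singleton] at hx
      rw [hx]
      exact hJ.2
    · intro x hx
      rw [List.mem_singleton] at hx
      subst hx
      intro s t hst hni
      simp only at hst hni ⊢
      have jp := P.ord p
      have jq := P.ord q
      have hs := hst.2.1 p
      have ht : I.ordMax + 1 ≤ (J.F t).ord := by
        by_cases e : p = s
        · have hqs : q ≠ s := by
            rintro rfl
            subst e
            exact hlca rfl
          have := hst.2.2 q hqs
          omega
        · have := hst.2.2 p e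
          omega
      exact meet_strict (n := I.ordMax + 1) (by omega) ht hni
    · intro x hx
      rw [List.mem_singleton] at hx
      subst hx
      intro hxi
      simp only at hxi ⊢
      have h1 := P.meet p q
      have h2 := meet_of_iso (hxi p q)
      have h3 := ord_le_max J p
      omega
    · intro G
      constructor
      · exact fun h => ⟨(J, 0), List.mem_singleton.2 rfl, h⟩
      · rintro ⟨x, hx, hxG⟩
        rw [List.mem_singleton] at hx
        subst hx
        exact hxG
    · simp
  have hfinal : CollProp (I.ordMax + 2) J L := coll_steps hcoll hinit
  have hbnd : ∀ x ∈ L, bnd x.1 = bnd I := fun x hx =>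
    (hfinal.bnd_eq x hx).trans (P.bnd_eq.trans b3)
  have hk : ∀ x ∈ L, x.1.k ≤ I.k - 2 - x.2 := by
    intro x hx
    have h1 := hfinal.fin x hx (hLiso x hx)
    have h2 := hbnd x hx
    unfold bnd at h2
    omega
  refine ⟨?_, hk, ?_⟩
  · -- safety
    have hhaf : ∀ G, IsHAF I.F G ↔ IsHAF I₁.F G ∨ IsHAF I₂.F G ∨ IsHAF I₃.F G := by
      intro G
      constructor
      · intro hG
        by_cases ha : NoCross G {a}
        · left
          intro i
          rw [hI₁F]
          exact cut_of_sub ((I.F i).singleton_mem a) ha (hG i)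
        by_cases hb : NoCross G {b}
        · right; left
          intro i
          rw [hI₂F]
          exact cut_of_sub ((I.F i).singleton_mem b) hb (hG i)
        right; right
        have hcl := mss_cluster hab hM (hG i0) ha hb
        intro i
        rw [hI₃F]
        simp only
        split_ifs with hi
        · exact hG i
        · exact sub_cut_eset (hsmall i hi) hcl (hG i)
      · rintro (hG | hG | hG) i
        · have := hG i
          rw [hI₁F] at this
          exact sub_of_cut (by simpa using (I.F i).singleton_mem a) this
        · have := hG i
          rw [hI₂F] at this
          exact sub_of_cut (by simpa using (I.F i).singleton_mem b) this
        · have := hG i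
          rw [hI₃F] at this
          simp only at this
          split_ifs at this with hi
          · exact this
          · exact sub_of_cut (fun d hd => (eset_spec (hsame i) hd).1) this
    constructor
    · rintro ⟨G, hG, hord⟩
      have hord' : (G.ord : ℤ) ≤ bnd I := hord
      rcases (hhaf G).1 hG with h | h | h
      · exact Or.inl (isYes_iff.2 ⟨G, h, b1 ▸ hord'⟩)
      · exact Or.inr (Or.inl (isYes_iff.2 ⟨G, h, b2 ▸ hord'⟩))
      · obtain ⟨x, hx, hxG⟩ := (hfinal.haf G).1 ((P.haf G).2 h)
        exact Or.inr (Or.inr ⟨x, hx, isYes_iff.2 ⟨G, hxG, by rw [hbnd x hx]; exact hord'⟩⟩)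
    · rintro (h | h | ⟨x, hx, h⟩)
      · obtain ⟨G, hG, hord⟩ := isYes_iff.1 h
        exact isYes_iff.2 ⟨G, (hhaf G).2 (Or.inl hG), b1 ▸ hord⟩
      · obtain ⟨G, hG, hord⟩ := isYes_iff.1 h
        exact isYes_iff.2 ⟨G, (hhaf G).2 (Or.inr (Or.inl hG)), b2 ▸ hord⟩
      · obtain ⟨G, hG, hord⟩ := isYes_iff.1 h
        refine isYes_iff.2 ⟨G, (hhaf G).2 (Or.inr (Or.inr ?_)), by rw [← hbnd x hx]; exact hord⟩
        exact (P.haf G).1 ((hfinal.haf G).2 ⟨x, hx, hG⟩)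
  · -- the recurrence
    intro T h0 hmono hT
    have hT' : ∀ x : ℤ, (2 : ℝ) * T (x - 1) + T (x - 2) ≤ T x := by
      intro x
      have := hT x
      push_cast at this
      linarith
    have hsum := sum_T_le h0 hmono hT' (I.k - 2) L hk
    rw [hfinal.kraft, one_mul] at hsum
    simp only [List.map_cons, List.sum_cons, List.map_map]
    rw [hI₁k, hI₂k]
    have e : (L.map (T ∘ fun x => x.1.k)).sum = (L.map fun x => T x.1.k).sum := rfl
    rw [e]
    have := hT' I.k
    linarith
end
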